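/- arXiv:2604.20294 — 2 statements merged into one kernel-verified Lean document; each statement's English description precedes it below -/
import Mathlib

section
/- Let X be an Archimedean lattice-ordered algebra with multiplicative identity 1_X. Then X admits a polynomial growth continuous function calculus (i.e., for every n ∈ ℕ and every x₁, …, xₙ ∈ X there is a lattice-algebra homomorphism Ψ : PG_n → X with Ψ(𝟙) = 1_X and Ψ(πᵢ) = xᵢ for i = 1, …, n) if and only if X is an f-algebra and for every n ∈ ℕ and every x₁, …, xₙ ∈ X there exists f ∈ X with f ≥ 1_X ∨ |x₁| ∨ ⋯ ∨ |xₙ| such that, for every m ∈ ℕ, the norm ‖·‖_{f^m} is complete on the ‖·‖_{f^m}-closed sublattice generated by x₁, …, xₙ in I_{f^m}. -/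
open scoped BigOperators

/-- A continuous function `ℝⁿ → ℝ` of polynomial growth (an element of `PG_n`). -/
def PolyGrowth (n : ℕ) (f : (Fin n → ℝ) → ℝ) : Prop :=
  Continuous f ∧ ∃ (M : ℝ) (N : ℕ), 0 ≤ M ∧
    ∀ t : Fin n → ℝ, |f t| ≤ M * (1 + ∑ i : Fin n, |t i|) ^ N

/-- An element of `PG_n^h`: a polynomial growth continuous function `f` such that
`f (t • x) / t` converges as `t → 0⁺`, uniformly in `x` on every bounded set. -/
def PolyGrowthH (n : ℕ) (f : (Fin n → ℝ) → ℝ) : Prop :=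
  PolyGrowth n f ∧ ∃ fh : (Fin n → ℝ) → ℝ,
    ∀ B : Set (Fin n → ℝ), Bornology.IsBounded B →
      ∀ ε : ℝ, 0 < ε → ∃ δ : ℝ, 0 < δ ∧
        ∀ t : ℝ, 0 < t → t < δ → ∀ y ∈ B, |f (t • y) / t - fh y| < ε

/-- An element of `H_n`: a continuous positively homogeneous function `ℝⁿ → ℝ`. -/
def PosHomog (n : ℕ) (f : (Fin n → ℝ) → ℝ) : Prop :=
  Continuous f ∧ ∀ (c : ℝ), 0 ≤ c → ∀ t : Fin n → ℝ, f (c • t) = c * f t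

section Defs

variable {X : Type*} [Lattice X] [AddCommGroup X] [Module ℝ X]

/-- The order ideal `I_e` generated by `e`. -/
def idealSet (e : X) : Set X := {x : X | ∃ c : ℝ, 0 ≤ c ∧ |x| ≤ c • e}

/-- The norm `‖x‖_e = inf {c ≥ 0 : |x| ≤ c • e}`. -/
noncomputable def regNorm (e x : X) : ℝ := sInf {c : ℝ | 0 ≤ c ∧ |x| ≤ c • e}

/-- The norm `‖·‖_e` is complete on the set `S`: every `‖·‖_e`-Cauchy sequence in `S`
converges, in `‖·‖_e`, to an element of `S`. -/
def NormComplete (e : X) (S : Set X) : Prop :=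
  ∀ u : ℕ → X, (∀ k, u k ∈ S) →
    (∀ ε : ℝ, 0 < ε → ∃ N : ℕ, ∀ p q : ℕ, N ≤ p → N ≤ q → regNorm e (u p - u q) < ε) →
    ∃ x ∈ S, ∀ ε : ℝ, 0 < ε → ∃ N : ℕ, ∀ p : ℕ, N ≤ p → regNorm e (u p - x) < ε

/-- A uniformly complete vector lattice: `(I_e, ‖·‖_e)` is complete for every `e ≥ 0`. -/
def UniformlyComplete (X : Type*) [Lattice X] [AddCommGroup X] [Module ℝ X] : Prop :=
  ∀ e : X, 0 ≤ e → NormComplete e (idealSet e)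

/-- A subset `Z` is uniformly complete as a vector lattice in its own right. -/
def UCSet (Z : Set X) : Prop :=
  ∀ e ∈ Z, 0 ≤ e → NormComplete e (Z ∩ idealSet e)

/-- A (vector) sublattice: a linear subspace closed under binary suprema. -/
def IsSublatticeSet (Z : Set X) : Prop :=
  (0 ∈ Z) ∧ (∀ a ∈ Z, ∀ b ∈ Z, a + b ∈ Z) ∧ (∀ (c : ℝ), ∀ a ∈ Z, c • a ∈ Z) ∧
  (∀ a ∈ Z, -a ∈ Z) ∧ (∀ a ∈ Z, ∀ b ∈ Z, a ⊔ b ∈ Z) ∧ (∀ a ∈ Z, ∀ b ∈ Z, a ⊓ b ∈ Z)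

/-- An order ideal: a linear subspace that is solid. -/
def IsOrderIdealSet (I : Set X) : Prop :=
  (0 ∈ I) ∧ (∀ a ∈ I, ∀ b ∈ I, a + b ∈ I) ∧ (∀ (c : ℝ), ∀ a ∈ I, c • a ∈ I) ∧
  (∀ a ∈ I, ∀ b : X, |b| ≤ |a| → b ∈ I)

/-- A vector lattice homomorphism defined on the class of functions `ℝⁿ → ℝ`
satisfying the predicate `P` (with pointwise operations), taking values in `X`. -/
def IsLatHom {n : ℕ} (P : ((Fin n → ℝ) → ℝ) → Prop) (Φ : ∀ f, P f → X) : Prop :=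
  (∀ (f g : (Fin n → ℝ) → ℝ) (hf : P f) (hg : P g) (hfg : P (f + g)),
      Φ (f + g) hfg = Φ f hf + Φ g hg) ∧
  (∀ (c : ℝ) (f : (Fin n → ℝ) → ℝ) (hf : P f) (hcf : P (c • f)),
      Φ (c • f) hcf = c • Φ f hf) ∧
  (∀ (f g : (Fin n → ℝ) → ℝ) (hf : P f) (hg : P g) (hfg : P (f ⊔ g)),
      Φ (f ⊔ g) hfg = Φ f hf ⊔ Φ g hg)

end Defs

section MulDefs

variable {X : Type*} [Lattice X] [AddCommGroup X] [Module ℝ X] [Mul X]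

/-- A lattice-algebra homomorphism defined on the class of functions `ℝⁿ → ℝ`
satisfying the predicate `P` (with pointwise operations), taking values in `X`. -/
def IsLatAlgHom {n : ℕ} (P : ((Fin n → ℝ) → ℝ) → Prop) (Ψ : ∀ f, P f → X) : Prop :=
  IsLatHom P Ψ ∧
  (∀ (f g : (Fin n → ℝ) → ℝ) (hf : P f) (hg : P g) (hfg : P (f * g)),
      Ψ (f * g) hfg = Ψ f hf * Ψ g hg)

/-- A sublattice-algebra: a linear subspace that is both a sublattice and a subalgebra. -/
def IsSublatticeAlgebraSet (Z : Set X) : Prop :=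
  IsSublatticeSet Z ∧ ∀ a ∈ Z, ∀ b ∈ Z, a * b ∈ Z

/-- The `f`-algebra condition, relativized to a subset. -/
def IsFAlgebraSet (Z : Set X) : Prop :=
  ∀ a ∈ Z, ∀ b ∈ Z, ∀ z ∈ Z, a ⊓ b = 0 → 0 ≤ z → (z * a) ⊓ b = 0 ∧ (a * z) ⊓ b = 0

/-- An `f`-subalgebra: a sublattice-algebra which is itself an `f`-algebra. -/
def IsFSubalgebra (Z : Set X) : Prop := IsSublatticeAlgebraSet Z ∧ IsFAlgebraSet Z

/-- `powS e m = e^(m+1)`, defined without assuming an identity element. -/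
def powS (e : X) : ℕ → X
  | 0 => e
  | m + 1 => powS e m * e

end MulDefs

/-- A map `T : X → A` which is a lattice-algebra homomorphism on a subset `S` of `X`. -/
def IsLatAlgHomOn {X A : Type*} [Lattice X] [AddCommGroup X] [Module ℝ X] [Mul X]
    [Lattice A] [AddCommGroup A] [Module ℝ A] [Mul A] (S : Set X) (T : X → A) : Prop :=
  (∀ a ∈ S, ∀ b ∈ S, T (a + b) = T a + T b) ∧
  (∀ (c : ℝ), ∀ a ∈ S, T (c • a) = c • T a) ∧
  (∀ a ∈ S, ∀ b ∈ S, T (a ⊔ b) = T a ⊔ T b) ∧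
  (∀ a ∈ S, ∀ b ∈ S, T (a * b) = T a * T b)


set_option linter.unusedSectionVars false

section LatticeOrderedAlgebra

variable {X : Type*} [Lattice X] [Ring X] [IsOrderedRing X]

theorem mul_le_abs_mul_abs [Module ℝ X] [IsOrderedModule ℝ X] (y z : X) :
    y * z ≤ |y| * |z| := by
  have h1 : 0 ≤ (|y| - y) * (|z| + z) :=
    mul_nonneg (sub_nonneg.2 (le_abs_self y)) (neg_le_iff_add_nonneg.1 (neg_le_abs z))
  have h2 : 0 ≤ (|y| + y) * (|z| - z) :=
    mul_nonneg (neg_le_iff_add_nonneg.1 (neg_le_abs y)) (sub_nonneg.2 (le_abs_self z))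
  have h3 := smul_nonneg (show (0 : ℝ) ≤ 1 / 2 by norm_num) (add_nonneg h1 h2)
  have h4 : (|y| - y) * (|z| + z) + (|y| + y) * (|z| - z) = (2 : ℝ) • (|y| * |z| - y * z) := by
    rw [two_smul]; noncomm_ring
  rw [h4, smul_smul] at h3
  norm_num at h3
  exact h3

theorem abs_mul_le_abs_mul_abs [Module ℝ X] [IsOrderedModule ℝ X] (y z : X) :
    |y * z| ≤ |y| * |z| := by
  refine abs_le'.2 ⟨mul_le_abs_mul_abs y z, ?_⟩
  have := mul_le_abs_mul_abs (-y) z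
  rwa [abs_neg, neg_mul] at this

theorem abs_real_smul_le [Module ℝ X] [IsOrderedModule ℝ X] (c : ℝ) (y : X) :
    |c • y| ≤ |c| • |y| := by
  have key : ∀ (d : ℝ) (v : X), 0 ≤ d → |d • v| ≤ d • |v| := fun d v hd =>
    abs_le'.2 ⟨smul_le_smul_of_nonneg_left (le_abs_self v) hd, by
      rw [← smul_neg]; exact smul_le_smul_of_nonneg_left (neg_le_abs v) hd⟩
  rcases le_total 0 c with h | h
  · rw [abs_of_nonneg h]; exact key c y h
  · rw [abs_of_nonpos h, ← abs_neg, ← neg_smul]; exact key (-c) y (by linarith)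

theorem abs_sup_sub_sup_le_add (a b c d : X) : |a ⊔ b - c ⊔ d| ≤ |a - c| + |b - d| := by
  have key : ∀ a b c d : X, a ⊔ b - c ⊔ d ≤ |a - c| + |b - d| := fun a b c d => by
    rw [sub_le_iff_le_add]
    refine sup_le ?_ ?_
    · calc a = (a - c) + 0 + c := by abel
        _ ≤ |a - c| + |b - d| + c ⊔ d :=
          add_le_add (add_le_add (le_abs_self _) (abs_nonneg _)) le_sup_left
    · calc b = 0 + (b - d) + d := by abel
        _ ≤ |a - c| + |b - d| + c ⊔ d :=
          add_le_add (add_le_add (abs_nonneg _) (le_abs_self _)) le_sup_right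
  refine abs_le'.2 ⟨key a b c d, ?_⟩
  rw [neg_sub, abs_sub_comm a c, abs_sub_comm b d]
  exact key c d a b

end LatticeOrderedAlgebra

section PrimeIdeals

variable {X : Type*} [Lattice X] [Ring X] [IsOrderedRing X] [Module ℝ X] [IsOrderedModule ℝ X]

/-- A two-sided ring ideal that is solid. -/
structure IsAlgIdeal (P : Set X) : Prop where
  zero_mem : 0 ∈ P
  add_mem : ∀ {a b : X}, a ∈ P → b ∈ P → a + b ∈ P
  solid : ∀ {a b : X}, a ∈ P → |b| ≤ |a| → b ∈ P
  mul_left : ∀ (z : X) {a : X}, a ∈ P → z * a ∈ P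
  mul_right : ∀ (z : X) {a : X}, a ∈ P → a * z ∈ P

theorem IsAlgIdeal.mem_of_abs_le {P : Set X} (hP : IsAlgIdeal P) {a b : X} (ha : a ∈ P)
    (h : |b| ≤ a) : b ∈ P :=
  hP.solid ha (h.trans (le_abs_self a))

theorem IsAlgIdeal.abs_mem {P : Set X} (hP : IsAlgIdeal P) {a : X} (ha : a ∈ P) : |a| ∈ P :=
  hP.solid ha (abs_abs a).le

/-- The solid ideal generated by a solid ideal `P` and a positive element `a`. -/
def adjoinIdeal (P : Set X) (a : X) : Set X :=
  {y | ∃ p ∈ P, ∃ r s : X, 0 ≤ p ∧ 0 ≤ r ∧ 0 ≤ s ∧ |y| ≤ p + r * a * s}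

theorem isAlgIdeal_adjoinIdeal {P : Set X} (hP : IsAlgIdeal P) {a : X} (ha : 0 ≤ a) :
    IsAlgIdeal (adjoinIdeal P a) where
  zero_mem := ⟨0, hP.zero_mem, 0, 0, le_rfl, le_rfl, le_rfl, by simp⟩
  add_mem := by
    rintro y z ⟨p, hp, r, s, hp0, hr, hs, hy⟩ ⟨p', hp', r', s', hp0', hr', hs', hz⟩
    refine ⟨p + p', hP.add_mem hp hp', r + r', s + s', add_nonneg hp0 hp0', add_nonneg hr hr',
      add_nonneg hs hs', ?_⟩
    have h1 : 0 ≤ r * a * s' := mul_nonneg (mul_nonneg hr ha) hs'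
    have h2 : 0 ≤ r' * a * s := mul_nonneg (mul_nonneg hr' ha) hs
    calc |y + z| ≤ |y| + |z| := abs_add_le y z
      _ ≤ (p + r * a * s) + (p' + r' * a * s') := add_le_add hy hz
      _ ≤ (p + r * a * s) + (p' + r' * a * s') + (r * a * s' + r' * a * s) :=
        le_add_of_nonneg_right (add_nonneg h1 h2)
      _ = p + p' + (r + r') * a * (s + s') := by noncomm_ring
  solid := by
    rintro y z ⟨p, hp, r, s, hp0, hr, hs, hy⟩ h
    exact ⟨p, hp, r, s, hp0, hr, hs, h.trans hy⟩
  mul_left := by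
    rintro z y ⟨p, hp, r, s, hp0, hr, hs, hy⟩
    refine ⟨|z| * p, hP.mul_left _ hp, |z| * r, s, mul_nonneg (abs_nonneg z) hp0,
      mul_nonneg (abs_nonneg z) hr, hs, (abs_mul_le_abs_mul_abs z y).trans ?_⟩
    calc |z| * |y| ≤ |z| * (p + r * a * s) := mul_le_mul_of_nonneg_left hy (abs_nonneg z)
      _ = _ := by noncomm_ring
  mul_right := by
    rintro z y ⟨p, hp, r, s, hp0, hr, hs, hy⟩
    refine ⟨p * |z|, hP.mul_right _ hp, r, s * |z|, mul_nonneg hp0 (abs_nonneg z),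
      hr, mul_nonneg hs (abs_nonneg z), (abs_mul_le_abs_mul_abs y z).trans ?_⟩
    calc |y| * |z| ≤ (p + r * a * s) * |z| := mul_le_mul_of_nonneg_right hy (abs_nonneg z)
      _ = _ := by noncomm_ring

theorem subset_adjoinIdeal {P : Set X} (hP : IsAlgIdeal P) (a : X) : P ⊆ adjoinIdeal P a :=
  fun y hy => ⟨|y|, hP.abs_mem hy, 0, 0, abs_nonneg y, le_rfl, le_rfl, by simp⟩

theorem mem_adjoinIdeal {P : Set X} (hP : IsAlgIdeal P) {a : X} (ha : 0 ≤ a) :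
    a ∈ adjoinIdeal P a :=
  ⟨0, hP.zero_mem, 1, 1, le_rfl, zero_le_one, zero_le_one, by simp [abs_of_nonneg ha]⟩

/-- In a unital `f`-algebra every nonzero element is avoided by a prime solid ideal. -/
theorem exists_prime_algIdeal
    (hF : ∀ a b z : X, a ⊓ b = 0 → 0 ≤ z → (z * a) ⊓ b = 0 ∧ (a * z) ⊓ b = 0)
    {w : X} (hw : w ≠ 0) :
    ∃ P : Set X, IsAlgIdeal P ∧ w ∉ P ∧ ∀ a b : X, a ⊓ b = 0 → a ∈ P ∨ b ∈ P := by
  obtain ⟨P, -, hP⟩ := zorn_subset_nonempty {P : Set X | IsAlgIdeal P ∧ w ∉ P} (by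
    intro c hc hchain ⟨Q, hQ⟩
    refine ⟨⋃₀ c, ⟨⟨⟨Q, hQ, (hc hQ).1.zero_mem⟩, ?_, ?_, ?_, ?_⟩, ?_⟩,
      fun s hs => Set.subset_sUnion_of_mem hs⟩
    · rintro a b ⟨A, hA, ha⟩ ⟨B, hB, hb⟩
      rcases hchain.total hA hB with h | h
      · exact ⟨B, hB, (hc hB).1.add_mem (h ha) hb⟩
      · exact ⟨A, hA, (hc hA).1.add_mem ha (h hb)⟩
    · rintro a b ⟨A, hA, ha⟩ h
      exact ⟨A, hA, (hc hA).1.solid ha h⟩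
    · rintro z a ⟨A, hA, ha⟩
      exact ⟨A, hA, (hc hA).1.mul_left z ha⟩
    · rintro z a ⟨A, hA, ha⟩
      exact ⟨A, hA, (hc hA).1.mul_right z ha⟩
    · rintro ⟨A, hA, ha⟩
      exact (hc hA).2 ha) {0} ⟨⟨rfl, by simp, by
        rintro a b rfl h
        rw [abs_zero] at h
        exact le_antisymm ((le_abs_self b).trans h) (neg_nonpos.1 ((neg_le_abs b).trans h)),
        by simp, by simp⟩, by simpa using hw⟩
  refine ⟨P, hP.prop.1, hP.prop.2, fun a b hab => ?_⟩
  by_contra! hcon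
  have ha : 0 ≤ a := hab ▸ inf_le_left
  have hb : 0 ≤ b := hab ▸ inf_le_right
  have key : ∀ v : X, 0 ≤ v → v ∉ P → w ∈ adjoinIdeal P v := by
    intro v hv hvP
    by_contra hwv
    exact hvP (hP.le_of_ge ⟨isAlgIdeal_adjoinIdeal hP.prop.1 hv, hwv⟩
      (subset_adjoinIdeal hP.prop.1 v) (mem_adjoinIdeal hP.prop.1 hv))
  obtain ⟨p, hp, r, s, hp0, hr, hs, h1⟩ := key a ha hcon.1
  obtain ⟨q, hq, r', s', hq0, hr', hs', h2⟩ := key b hb hcon.2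
  have h3 : (r * a * s) ⊓ (r' * b * s') = 0 := by
    have e1 := (hF _ _ s (hF a b r hab hr).1 hs).2
    rw [inf_comm] at e1
    have e2 := (hF _ _ s' (hF _ _ r' e1 hr').1 hs').2
    rwa [inf_comm] at e2
  refine hP.prop.2 (hP.prop.1.mem_of_abs_le (hP.prop.1.add_mem hp hq) ?_)
  have n1 : 0 ≤ r * a * s := mul_nonneg (mul_nonneg hr ha) hs
  have n2 : 0 ≤ r' * b * s' := mul_nonneg (mul_nonneg hr' hb) hs'
  have h4 : |w| - (p + q) ≤ (r * a * s) ⊓ (r' * b * s') := by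
    refine le_inf ?_ ?_
    · rw [sub_le_iff_le_add]
      calc |w| ≤ p + r * a * s := h1
        _ ≤ p + r * a * s + q := le_add_of_nonneg_right hq0
        _ = _ := by abel
    · rw [sub_le_iff_le_add]
      calc |w| ≤ q + r' * b * s' := h2
        _ ≤ q + r' * b * s' + p := le_add_of_nonneg_right hp0
        _ = _ := by abel
  rw [h3] at h4
  exact sub_nonpos.1 h4

end PrimeIdeals

section StandardPart

variable {X : Type*} [Lattice X] [Ring X] [IsOrderedRing X] [Module ℝ X] [IsOrderedModule ℝ X]
  [IsScalarTower ℝ X X] [SMulCommClass ℝ X X]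

/-- `a ≤ b` modulo the solid ideal `P`. -/
def LeMod (P : Set X) (a b : X) : Prop := ∃ p ∈ P, 0 ≤ p ∧ a ≤ b + p

/-- `y` is bounded by a multiple of `1` modulo `P`. -/
def FiniteMod (P : Set X) (y : X) : Prop := ∃ C : ℝ, 0 ≤ C ∧ LeMod P |y| (C • (1 : X))

/-- `y` is infinitesimal with respect to `1` modulo `P`. -/
def SmallMod (P : Set X) (y : X) : Prop := ∀ ε : ℝ, 0 < ε → LeMod P |y| (ε • (1 : X))

variable {P : Set X}

namespace IsAlgIdeal

theorem smul_mem (hP : IsAlgIdeal P) (c : ℝ) {a : X} (ha : a ∈ P) : c • a ∈ P := by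
  have := hP.mul_left (c • (1 : X)) ha
  rwa [smul_mul_assoc, one_mul] at this

theorem leMod_of_le (hP : IsAlgIdeal P) {a b : X} (h : a ≤ b) : LeMod P a b :=
  ⟨0, hP.zero_mem, le_rfl, by simpa using h⟩

theorem leMod_trans (hP : IsAlgIdeal P) {a b c : X} : LeMod P a b → LeMod P b c → LeMod P a c := by
  rintro ⟨p, hp, hp0, h⟩ ⟨q, hq, hq0, h'⟩
  refine ⟨q + p, hP.add_mem hq hp, add_nonneg hq0 hp0, h.trans ?_⟩
  rw [← add_assoc]
  exact add_le_add_left h' p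

theorem leMod_add (hP : IsAlgIdeal P) {a b c d : X} :
    LeMod P a b → LeMod P c d → LeMod P (a + c) (b + d) := by
  rintro ⟨p, hp, hp0, h⟩ ⟨q, hq, hq0, h'⟩
  refine ⟨p + q, hP.add_mem hp hq, add_nonneg hp0 hq0, (add_le_add h h').trans_eq ?_⟩
  abel

theorem leMod_smul (hP : IsAlgIdeal P) {a b : X} {c : ℝ} (hc : 0 ≤ c) :
    LeMod P a b → LeMod P (c • a) (c • b) := by
  rintro ⟨p, hp, hp0, h⟩
  refine ⟨c • p, hP.smul_mem c hp, smul_nonneg hc hp0, ?_⟩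
  rw [← smul_add]
  exact smul_le_smul_of_nonneg_left h hc

theorem leMod_mul_right (hP : IsAlgIdeal P) {a b c : X} (hc : 0 ≤ c) :
    LeMod P a b → LeMod P (a * c) (b * c) := by
  rintro ⟨p, hp, hp0, h⟩
  refine ⟨p * c, hP.mul_right c hp, mul_nonneg hp0 hc, ?_⟩
  rw [← add_mul]
  exact mul_le_mul_of_nonneg_right h hc

theorem leMod_mul_left (hP : IsAlgIdeal P) {a b c : X} (hc : 0 ≤ c) :
    LeMod P a b → LeMod P (c * a) (c * b) := by
  rintro ⟨p, hp, hp0, h⟩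
  refine ⟨c * p, hP.mul_left c hp, mul_nonneg hc hp0, ?_⟩
  rw [← mul_add]
  exact mul_le_mul_of_nonneg_left h hc

theorem leMod_sup (hP : IsAlgIdeal P) {a b c : X} :
    LeMod P a c → LeMod P b c → LeMod P (a ⊔ b) c := by
  rintro ⟨p, hp, hp0, h⟩ ⟨q, hq, hq0, h'⟩
  refine ⟨p + q, hP.add_mem hp hq, add_nonneg hp0 hq0, sup_le (h.trans ?_) (h'.trans ?_)⟩
  · exact add_le_add le_rfl (le_add_of_nonneg_right hq0)
  · exact add_le_add le_rfl (le_add_of_nonneg_left hp0)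

theorem one_mem_of_leMod (hP : IsAlgIdeal P) {r s : ℝ} (h : s < r)
    (hrs : LeMod P (r • (1 : X)) (s • (1 : X))) : (1 : X) ∈ P := by
  obtain ⟨p, hp, hp0, hle⟩ := hrs
  have h1 : (r - s) • (1 : X) ≤ p := by
    rw [sub_smul, sub_le_iff_le_add, add_comm]; exact hle
  have h2 := smul_le_smul_of_nonneg_left h1 (inv_nonneg.2 (sub_pos.2 h).le)
  rw [smul_smul, inv_mul_cancel₀ (sub_pos.2 h).ne', one_smul] at h2
  exact hP.mem_of_abs_le (hP.smul_mem _ hp) (by rwa [abs_of_nonneg zero_le_one])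

theorem leMod_total (_hP : IsAlgIdeal P) (hprime : ∀ a b : X, a ⊓ b = 0 → a ∈ P ∨ b ∈ P)
    (a b : X) : LeMod P a b ∨ LeMod P b a := by
  rcases hprime _ _ (posPart_inf_negPart_eq_zero (a - b)) with h | h
  · refine Or.inl ⟨_, h, posPart_nonneg _, ?_⟩
    rw [← sub_le_iff_le_add']
    exact le_posPart _
  · refine Or.inr ⟨_, h, negPart_nonneg _, ?_⟩
    rw [← sub_le_iff_le_add', ← neg_sub]
    exact neg_le_negPart _

theorem smallMod_of_abs_le (hP : IsAlgIdeal P) {y z : X} (hz : SmallMod P z) (h : |y| ≤ |z|) :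
    SmallMod P y :=
  fun ε hε => hP.leMod_trans (hP.leMod_of_le h) (hz ε hε)

theorem smallMod_zero (hP : IsAlgIdeal P) : SmallMod P (0 : X) := fun ε hε =>
  hP.leMod_of_le (by rw [abs_zero]; exact smul_nonneg hε.le zero_le_one)

theorem smallMod_add (hP : IsAlgIdeal P) {y z : X} (hy : SmallMod P y) (hz : SmallMod P z) :
    SmallMod P (y + z) := fun ε hε => by
  have := hP.leMod_add (hy (ε / 2) (half_pos hε)) (hz (ε / 2) (half_pos hε))
  rw [← add_smul, add_halves] at this
  exact hP.leMod_trans (hP.leMod_of_le (abs_add_le y z)) this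

theorem smallMod_smul (hP : IsAlgIdeal P) {y : X} (c : ℝ) (hy : SmallMod P y) :
    SmallMod P (c • y) := fun ε hε => by
  have hc : 0 < |c| + 1 := by positivity
  have h := hP.leMod_smul hc.le (hy (ε / (|c| + 1)) (div_pos hε hc))
  rw [smul_smul, mul_div_cancel₀ _ hc.ne'] at h
  refine hP.leMod_trans (hP.leMod_of_le ((abs_real_smul_le c y).trans ?_)) h
  exact smul_le_smul_of_nonneg_right (by linarith) (abs_nonneg y)

theorem smallMod_mul_right (hP : IsAlgIdeal P) {y z : X} (hy : SmallMod P y)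
    (hz : FiniteMod P z) : SmallMod P (y * z) := fun ε hε => by
  obtain ⟨C, hC, hz⟩ := hz
  have hC1 : 0 < C + 1 := by positivity
  have h1 := hP.leMod_mul_right (abs_nonneg z) (hy (ε / (C + 1)) (div_pos hε hC1))
  have h2 := hP.leMod_smul (div_pos hε hC1).le hz
  rw [smul_mul_assoc, one_mul] at h1
  refine hP.leMod_trans (hP.leMod_of_le (abs_mul_le_abs_mul_abs y z))
    (hP.leMod_trans h1 (hP.leMod_trans h2 (hP.leMod_of_le ?_)))
  rw [smul_smul]
  refine smul_le_smul_of_nonneg_right ?_ zero_le_one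
  rw [div_mul_eq_mul_div, div_le_iff₀ hC1]
  nlinarith

theorem finiteMod_of_abs_le (hP : IsAlgIdeal P) {y z : X} (hz : FiniteMod P z) (h : |y| ≤ |z|) :
    FiniteMod P y := by
  obtain ⟨C, hC, hz⟩ := hz
  exact ⟨C, hC, hP.leMod_trans (hP.leMod_of_le h) hz⟩

theorem finiteMod_smul (hP : IsAlgIdeal P) {y : X} (c : ℝ) (hy : FiniteMod P y) :
    FiniteMod P (c • y) := by
  obtain ⟨C, hC, hy⟩ := hy
  refine ⟨|c| * C, by positivity, hP.leMod_trans (hP.leMod_of_le (abs_real_smul_le c y)) ?_⟩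
  rw [← smul_smul]
  exact hP.leMod_smul (abs_nonneg c) hy

theorem finiteMod_mul (hP : IsAlgIdeal P) {y z : X} (hy : FiniteMod P y) (hz : FiniteMod P z) :
    FiniteMod P (y * z) := by
  obtain ⟨C, hC, hy⟩ := hy
  obtain ⟨D, hD, hz⟩ := hz
  refine ⟨C * D, by positivity, hP.leMod_trans (hP.leMod_of_le (abs_mul_le_abs_mul_abs y z)) ?_⟩
  have h1 := hP.leMod_mul_right (abs_nonneg z) hy
  have h2 := hP.leMod_smul hC hz
  rw [smul_mul_assoc, one_mul] at h1
  rw [← smul_smul]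
  exact hP.leMod_trans h1 h2

theorem finiteMod_one (hP : IsAlgIdeal P) : FiniteMod P (1 : X) :=
  ⟨1, zero_le_one, hP.leMod_of_le (by rw [one_smul, abs_of_nonneg zero_le_one])⟩

theorem finiteMod_pow (hP : IsAlgIdeal P) {y : X} (hy : FiniteMod P y) (k : ℕ) :
    FiniteMod P (y ^ k) := by
  induction k with
  | zero => rw [pow_zero]; exact hP.finiteMod_one
  | succ k ih => rw [pow_succ]; exact hP.finiteMod_mul ih hy

theorem eq_of_smallMod_sub (hP : IsAlgIdeal P) (h1 : (1 : X) ∉ P) {y : X} {r s : ℝ}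
    (hr : SmallMod P (y - r • (1 : X))) (hs : SmallMod P (y - s • (1 : X))) : r = s := by
  have key : ∀ r s : ℝ, SmallMod P (y - r • (1 : X)) → SmallMod P (y - s • (1 : X)) → r ≤ s := by
    intro r s hr hs
    by_contra! hlt
    have hε : 0 < (r - s) / 3 := by linarith
    have h2 := hP.leMod_add (hr _ hε) (hs _ hε)
    rw [← add_smul] at h2
    refine h1 (hP.one_mem_of_leMod (r := r - s) (by linarith) (hP.leMod_trans
      (hP.leMod_of_le ?_) h2))
    calc (r - s) • (1 : X) = -(y - r • (1 : X)) + (y - s • (1 : X)) := by rw [sub_smul]; abel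
      _ ≤ _ := add_le_add (neg_le_abs _) (le_abs_self _)
  exact le_antisymm (key r s hr hs) (key s r hs hr)

theorem exists_smallMod_sub (hP : IsAlgIdeal P) (h1 : (1 : X) ∉ P)
    (hprime : ∀ a b : X, a ⊓ b = 0 → a ∈ P ∨ b ∈ P) {y : X} (hy : FiniteMod P y) :
    ∃ r : ℝ, SmallMod P (y - r • (1 : X)) := by
  obtain ⟨C, hC, hy⟩ := hy
  set S : Set ℝ := {r | LeMod P (r • (1 : X)) y}
  have hSne : S.Nonempty := by
    refine ⟨-C, ?_⟩
    obtain ⟨p, hp, hp0, h⟩ := hy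
    refine ⟨p, hp, hp0, ?_⟩
    have h3 := (neg_le_abs y).trans h
    rw [neg_smul, neg_le_iff_add_nonneg]
    rw [neg_le_iff_add_nonneg] at h3
    exact h3.trans_eq (by abel)
  have hSb : BddAbove S := by
    refine ⟨C, fun r hr => ?_⟩
    by_contra! hlt
    exact h1 (hP.one_mem_of_leMod hlt
      (hP.leMod_trans hr (hP.leMod_trans (hP.leMod_of_le (le_abs_self y)) hy)))
  refine ⟨sSup S, fun ε hε => hP.leMod_sup ?_ ?_⟩
  · have hn : sSup S + ε ∉ S := fun h => by linarith [le_csSup hSb h]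
    have h2 : LeMod P y ((sSup S + ε) • (1 : X)) :=
      (hP.leMod_total hprime y _).resolve_right hn
    have h3 := hP.leMod_add h2 (hP.leMod_of_le (le_refl (-(sSup S • (1 : X)))))
    rw [add_smul] at h3
    convert h3 using 1
    · abel
    · abel
  · obtain ⟨s, hs, hlt⟩ := exists_lt_of_lt_csSup hSne (show sSup S - ε < sSup S by linarith)
    have h2 : LeMod P ((sSup S - ε) • (1 : X)) y :=
      hP.leMod_trans (hP.leMod_of_le (smul_le_smul_of_nonneg_right hlt.le zero_le_one)) hs
    have h3 := hP.leMod_add h2 (hP.leMod_of_le (le_refl (ε • (1 : X) - y)))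
    rw [sub_smul] at h3
    convert h3 using 1
    · abel
    · abel

end IsAlgIdeal

end StandardPart

section Characters

variable {X : Type*} [Lattice X] [Ring X] [IsOrderedRing X] [Module ℝ X] [IsOrderedModule ℝ X]
  [IsScalarTower ℝ X X] [SMulCommClass ℝ X X]

/-- The elements dominated by a multiple of a power of `f`. -/
def growthSet (f : X) : Set X := {y | ∃ (C : ℝ) (k : ℕ), 0 ≤ C ∧ |y| ≤ C • f ^ k}

/-- A unital real-valued lattice-algebra homomorphism on `growthSet f`. -/
structure IsCharOn (f : X) (ω : X → ℝ) : Prop where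
  hom : IsLatAlgHomOn (growthSet f) ω
  one : ω 1 = 1

theorem one_mem_growthSet (f : X) : (1 : X) ∈ growthSet f :=
  ⟨1, 0, zero_le_one, by rw [pow_zero, one_smul, abs_of_nonneg zero_le_one]⟩

theorem growthSet_solid {f a b : X} (ha : a ∈ growthSet f) (h : |b| ≤ |a|) :
    b ∈ growthSet f := by
  obtain ⟨C, k, hC, ha⟩ := ha
  exact ⟨C, k, hC, h.trans ha⟩

theorem growthSet_abs {f a : X} (ha : a ∈ growthSet f) : |a| ∈ growthSet f :=
  growthSet_solid ha (abs_abs a).le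

theorem growthSet_add {f a b : X} (hf : 1 ≤ f) (ha : a ∈ growthSet f) (hb : b ∈ growthSet f) :
    a + b ∈ growthSet f := by
  obtain ⟨C, k, hC, ha⟩ := ha
  obtain ⟨D, l, hD, hb⟩ := hb
  refine ⟨C + D, max k l, add_nonneg hC hD, (abs_add_le a b).trans ?_⟩
  rw [add_smul]
  exact add_le_add
    (ha.trans (smul_le_smul_of_nonneg_left (pow_le_pow_right₀ hf (le_max_left k l)) hC))
    (hb.trans (smul_le_smul_of_nonneg_left (pow_le_pow_right₀ hf (le_max_right k l)) hD))

theorem growthSet_smul {f a : X} (c : ℝ) (ha : a ∈ growthSet f) : c • a ∈ growthSet f := by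
  obtain ⟨C, k, hC, ha⟩ := ha
  refine ⟨|c| * C, k, mul_nonneg (abs_nonneg c) hC, (abs_real_smul_le c a).trans ?_⟩
  rw [← smul_smul]
  exact smul_le_smul_of_nonneg_left ha (abs_nonneg c)

theorem growthSet_neg {f a : X} (ha : a ∈ growthSet f) : -a ∈ growthSet f :=
  growthSet_solid ha (abs_neg a).le

theorem growthSet_sub {f a b : X} (hf : 1 ≤ f) (ha : a ∈ growthSet f) (hb : b ∈ growthSet f) :
    a - b ∈ growthSet f := by
  rw [sub_eq_add_neg]
  exact growthSet_add hf ha (growthSet_neg hb)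

theorem growthSet_sup {f a b : X} (hf : 1 ≤ f) (ha : a ∈ growthSet f) (hb : b ∈ growthSet f) :
    a ⊔ b ∈ growthSet f := by
  refine growthSet_solid (growthSet_add hf (growthSet_abs ha) (growthSet_abs hb)) ?_
  rw [abs_of_nonneg (add_nonneg (abs_nonneg a) (abs_nonneg b))]
  simpa using abs_sup_sub_sup_le_add a b 0 0

theorem growthSet_mul {f a b : X} (ha : a ∈ growthSet f) (hb : b ∈ growthSet f) :
    a * b ∈ growthSet f := by
  obtain ⟨C, k, hC, ha⟩ := ha
  obtain ⟨D, l, hD, hb⟩ := hb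
  refine ⟨C * D, k + l, mul_nonneg hC hD, (abs_mul_le_abs_mul_abs a b).trans ?_⟩
  calc |a| * |b| ≤ (C • f ^ k) * (D • f ^ l) :=
        mul_le_mul ha hb (abs_nonneg b) ((abs_nonneg a).trans ha)
    _ = _ := by rw [smul_mul_smul_comm, pow_add]

theorem self_mem_growthSet {f : X} (hf : 1 ≤ f) : f ∈ growthSet f :=
  ⟨1, 1, zero_le_one, by rw [pow_one, one_smul, abs_of_nonneg (zero_le_one.trans hf)]⟩

theorem growthSet_pow {f a : X} (ha : a ∈ growthSet f) (k : ℕ) : a ^ k ∈ growthSet f := by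
  induction k with
  | zero => rw [pow_zero]; exact one_mem_growthSet f
  | succ k ih => rw [pow_succ]; exact growthSet_mul ih ha

namespace IsCharOn

variable {f : X} {ω : X → ℝ}

theorem map_add (h : IsCharOn f ω) {a b : X} (ha : a ∈ growthSet f) (hb : b ∈ growthSet f) :
    ω (a + b) = ω a + ω b := h.hom.1 a ha b hb

theorem map_smul (h : IsCharOn f ω) (c : ℝ) {a : X} (ha : a ∈ growthSet f) :
    ω (c • a) = c * ω a := h.hom.2.1 c a ha

theorem map_sup (h : IsCharOn f ω) {a b : X} (ha : a ∈ growthSet f) (hb : b ∈ growthSet f) :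
    ω (a ⊔ b) = ω a ⊔ ω b := h.hom.2.2.1 a ha b hb

theorem map_mul (h : IsCharOn f ω) {a b : X} (ha : a ∈ growthSet f) (hb : b ∈ growthSet f) :
    ω (a * b) = ω a * ω b := h.hom.2.2.2 a ha b hb

theorem map_neg (h : IsCharOn f ω) {a : X} (ha : a ∈ growthSet f) : ω (-a) = -ω a := by
  rw [← neg_one_smul ℝ a, h.map_smul _ ha]; ring

theorem map_sub (h : IsCharOn f ω) {a b : X} (ha : a ∈ growthSet f) (hb : b ∈ growthSet f) :
    ω (a - b) = ω a - ω b := by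
  rw [sub_eq_add_neg, h.map_add ha (growthSet_neg hb), h.map_neg hb, sub_eq_add_neg]

theorem map_abs (h : IsCharOn f ω) {a : X} (ha : a ∈ growthSet f) : ω |a| = |ω a| := by
  rw [abs, h.map_sup ha (growthSet_neg ha), h.map_neg ha]; rfl

theorem map_inf (h : IsCharOn f ω) (hf : 1 ≤ f) {a b : X} (ha : a ∈ growthSet f)
    (hb : b ∈ growthSet f) : ω (a ⊓ b) = ω a ⊓ ω b := by
  rw [← neg_neg (a ⊓ b), neg_inf,
    h.map_neg (growthSet_sup hf (growthSet_neg ha) (growthSet_neg hb)),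
    h.map_sup (growthSet_neg ha) (growthSet_neg hb), h.map_neg ha, h.map_neg hb, ← neg_inf, neg_neg]

theorem map_mono (h : IsCharOn f ω) {a b : X} (ha : a ∈ growthSet f) (hb : b ∈ growthSet f)
    (hab : a ≤ b) : ω a ≤ ω b := by
  have := h.map_sup ha hb
  rw [sup_eq_right.2 hab] at this
  rw [this]
  exact le_sup_left

theorem map_pow (h : IsCharOn f ω) {a : X} (ha : a ∈ growthSet f) (k : ℕ) :
    ω (a ^ k) = ω a ^ k := by
  induction k with
  | zero => rw [pow_zero, pow_zero, h.one]
  | succ k ih => rw [pow_succ, pow_succ, h.map_mul (growthSet_pow ha k) ha, ih]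

end IsCharOn

/-- A prime solid ideal modulo which `f` is finite gives a character: the standard part. -/
theorem exists_isCharOn_of_prime {P : Set X} (hP : IsAlgIdeal P) (h1 : (1 : X) ∉ P)
    (hprime : ∀ a b : X, a ⊓ b = 0 → a ∈ P ∨ b ∈ P) {f : X} (hf1 : 1 ≤ f) (hf : FiniteMod P f) :
    ∃ ω : X → ℝ, IsCharOn f ω ∧ ∀ y ∈ growthSet f, SmallMod P (y - ω y • (1 : X)) := by
  have hfin : ∀ y ∈ growthSet f, FiniteMod P y := by
    rintro y ⟨C, k, hC, hy⟩
    exact hP.finiteMod_of_abs_le (hP.finiteMod_smul C (hP.finiteMod_pow hf k))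
      (hy.trans (le_abs_self _))
  have hex : ∀ y : X, ∃ r : ℝ, y ∈ growthSet f → SmallMod P (y - r • (1 : X)) := by
    intro y
    by_cases hy : y ∈ growthSet f
    · obtain ⟨r, hr⟩ := hP.exists_smallMod_sub h1 hprime (hfin y hy)
      exact ⟨r, fun _ => hr⟩
    · exact ⟨0, fun h => absurd h hy⟩
  choose ω hω using hex
  have huniq : ∀ (y : X) (r : ℝ), y ∈ growthSet f → SmallMod P (y - r • (1 : X)) → ω y = r :=
    fun y r hy hr => hP.eq_of_smallMod_sub h1 (hω y hy) hr
  refine ⟨ω, ⟨⟨fun a ha b hb => ?_, fun c a ha => ?_, fun a ha b hb => ?_, fun a ha b hb => ?_⟩,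
    ?_⟩, hω⟩
  · refine huniq _ _ (growthSet_add hf1 ha hb) ?_
    have h := hP.smallMod_add (hω a ha) (hω b hb)
    rw [add_smul]
    convert h using 1
    abel
  · refine huniq _ _ (growthSet_smul c ha) ?_
    have h := hP.smallMod_smul c (hω a ha)
    rwa [smul_sub, smul_smul] at h
  · refine huniq _ _ (growthSet_sup hf1 ha hb) ?_
    have h := hP.smallMod_add (hP.smallMod_of_abs_le (hω a ha) (abs_abs _).le)
      (hP.smallMod_of_abs_le (hω b hb) (abs_abs _).le)
    have hmono : ∀ r s : ℝ, (r ⊔ s) • (1 : X) = r • (1 : X) ⊔ s • (1 : X) := fun r s =>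
      Monotone.map_sup (fun _ _ h => smul_le_smul_of_nonneg_right h zero_le_one) r s
    refine hP.smallMod_of_abs_le h ?_
    rw [hmono]
    exact (abs_sup_sub_sup_le_add _ _ _ _).trans (le_abs_self _)
  · refine huniq _ _ (growthSet_mul ha hb) ?_
    have h := hP.smallMod_add (hP.smallMod_mul_right (hω a ha) (hfin b hb))
      (hP.smallMod_smul (ω a) (hω b hb))
    rw [sub_mul, smul_mul_assoc, one_mul, smul_sub, smul_smul, sub_add_sub_cancel] at h
    exact h
  · refine huniq _ _ (one_mem_growthSet f) ?_
    rw [one_smul, sub_self]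
    exact hP.smallMod_zero

theorem exists_char_pos
    (hF : ∀ a b z : X, a ⊓ b = 0 → 0 ≤ z → (z * a) ⊓ b = 0 ∧ (a * z) ⊓ b = 0)
    (harch : ∀ y z : X, 0 ≤ y → 0 ≤ z → (∀ k : ℕ, k • y ≤ z) → y = 0)
    {f w : X} (hf : 1 ≤ f) (hw : w ∈ growthSet f) (hpos : ¬ w ≤ 0) :
    ∃ ω : X → ℝ, IsCharOn f ω ∧ 0 < ω w := by
  obtain ⟨C, m, hC, hwm⟩ := hw
  have hf0 : 0 ≤ f := zero_le_one.trans hf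
  obtain ⟨ε, hε, hne⟩ : ∃ ε : ℝ, 0 < ε ∧ (w - ε • f ^ (m + 1))⁺ ≠ 0 := by
    by_contra! hcon
    refine hpos (posPart_eq_zero.1 (harch _ (f ^ (m + 1)) (posPart_nonneg w) (pow_nonneg hf0 _)
      fun k => ?_))
    rcases Nat.eq_zero_or_pos k with rfl | hk
    · rw [zero_smul]; exact pow_nonneg hf0 _
    · have hk' : (0 : ℝ) < k := by exact_mod_cast hk
      have h1 := posPart_eq_zero.1 (hcon (k : ℝ)⁻¹ (inv_pos.2 hk'))
      have h2 : w⁺ ≤ (k : ℝ)⁻¹ • f ^ (m + 1) :=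
        sup_le (sub_nonpos.1 h1) (smul_nonneg (inv_pos.2 hk').le (pow_nonneg hf0 _))
      have h3 := smul_le_smul_of_nonneg_left h2 hk'.le
      rwa [smul_smul, mul_inv_cancel₀ hk'.ne', one_smul, Nat.cast_smul_eq_nsmul] at h3
  obtain ⟨P, hP, hwP, hprime⟩ := exists_prime_algIdeal hF hne
  have h1 : (1 : X) ∉ P := fun h => hwP (by simpa using hP.mul_left (w - ε • f ^ (m + 1))⁺ h)
  have hnle : ¬ LeMod P w (ε • f ^ (m + 1)) := by
    rintro ⟨p, hp, hp0, hle⟩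
    refine hwP (hP.mem_of_abs_le hp ?_)
    rw [abs_of_nonneg (posPart_nonneg _)]
    exact sup_le (sub_le_iff_le_add'.2 hle) hp0
  have hge : LeMod P (ε • f ^ (m + 1)) w := (hP.leMod_total hprime _ _).resolve_left hnle
  have hfin : FiniteMod P f := by
    refine ⟨C / ε, div_nonneg hC hε.le, ?_⟩
    rw [abs_of_nonneg hf0]
    refine (hP.leMod_total hprime _ _).resolve_right fun h => hnle ?_
    have h2 := hP.leMod_smul hε.le (hP.leMod_mul_left (pow_nonneg hf0 m) h)
    rw [mul_smul_comm, smul_smul, mul_div_cancel₀ _ hε.ne', mul_one, ← pow_succ] at h2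
    exact hP.leMod_trans (hP.leMod_of_le ((le_abs_self w).trans hwm)) h2
  obtain ⟨ω, hω, hsmall⟩ := exists_isCharOn_of_prime hP h1 hprime hf hfin
  refine ⟨ω, hω, ?_⟩
  by_contra! hle
  have h2 := hsmall w ⟨C, m, hC, hwm⟩ (ε / 2) (half_pos hε)
  have h3 : LeMod P (ε • (1 : X)) w := hP.leMod_trans
    (hP.leMod_of_le (smul_le_smul_of_nonneg_left (one_le_pow₀ hf) hε.le)) hge
  have h4 := hP.leMod_add h3 h2
  have h5 : LeMod P (ε • (1 : X) - ω w • (1 : X)) ((ε / 2) • (1 : X)) := by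
    have h6 := hP.leMod_add h4 (hP.leMod_of_le (le_refl (-w)))
    refine hP.leMod_trans (hP.leMod_of_le ?_) (hP.leMod_trans h6 (hP.leMod_of_le ?_))
    · calc ε • (1 : X) - ω w • (1 : X) = ε • (1 : X) + (w - ω w • (1 : X)) + -w := by abel
        _ ≤ _ := add_le_add (add_le_add le_rfl (le_abs_self _)) le_rfl
    · exact le_of_eq (by abel)
  rw [← sub_smul] at h5
  exact h1 (hP.one_mem_of_leMod (by linarith) h5)

theorem le_of_forall_char
    (hF : ∀ a b z : X, a ⊓ b = 0 → 0 ≤ z → (z * a) ⊓ b = 0 ∧ (a * z) ⊓ b = 0)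
    (harch : ∀ y z : X, 0 ≤ y → 0 ≤ z → (∀ k : ℕ, k • y ≤ z) → y = 0)
    {f a b : X} (hf : 1 ≤ f) (ha : a ∈ growthSet f) (hb : b ∈ growthSet f)
    (h : ∀ ω : X → ℝ, IsCharOn f ω → ω a ≤ ω b) : a ≤ b := by
  by_contra hcon
  obtain ⟨ω, hω, hlt⟩ := exists_char_pos hF harch hf (growthSet_sub hf ha hb)
    (fun h => hcon (sub_nonpos.1 h))
  rw [hω.map_sub ha hb] at hlt
  linarith [h ω hω]

theorem eq_of_forall_char
    (hF : ∀ a b z : X, a ⊓ b = 0 → 0 ≤ z → (z * a) ⊓ b = 0 ∧ (a * z) ⊓ b = 0)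
    (harch : ∀ y z : X, 0 ≤ y → 0 ≤ z → (∀ k : ℕ, k • y ≤ z) → y = 0)
    {f a b : X} (hf : 1 ≤ f) (ha : a ∈ growthSet f) (hb : b ∈ growthSet f)
    (h : ∀ ω : X → ℝ, IsCharOn f ω → ω a = ω b) : a = b :=
  le_antisymm (le_of_forall_char hF harch hf ha hb fun ω hω => (h ω hω).le)
    (le_of_forall_char hF harch hf hb ha fun ω hω => (h ω hω).ge)

end Characters

section RegularNorm

variable {X : Type*} [Lattice X] [Ring X] [IsOrderedRing X] [Module ℝ X] [IsOrderedModule ℝ X]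

theorem regNorm_le {e x : X} {c : ℝ} (hc : 0 ≤ c) (h : |x| ≤ c • e) : regNorm e x ≤ c :=
  csInf_le ⟨0, fun _ hd => hd.1⟩ ⟨hc, h⟩

theorem abs_le_of_regNorm_lt {e x : X} (he : 0 ≤ e) {c : ℝ} (hx : x ∈ idealSet e)
    (h : regNorm e x < c) : |x| ≤ c • e := by
  obtain ⟨d, ⟨-, hd⟩, hdc⟩ := exists_lt_of_csInf_lt hx h
  exact hd.trans (smul_le_smul_of_nonneg_right hdc.le he)

theorem isSublatticeSet_idealSet (e : X) : IsSublatticeSet (idealSet e) := by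
  have hadd : ∀ a ∈ idealSet e, ∀ b ∈ idealSet e, |a| + |b| ∈ idealSet e := by
    rintro a ⟨c, hc, ha⟩ b ⟨d, hd, hb⟩
    refine ⟨c + d, add_nonneg hc hd, ?_⟩
    rw [abs_of_nonneg (add_nonneg (abs_nonneg a) (abs_nonneg b)), add_smul]
    exact add_le_add ha hb
  have hsolid : ∀ a ∈ idealSet e, ∀ b : X, |b| ≤ |a| → b ∈ idealSet e := by
    rintro a ⟨c, hc, ha⟩ b hb
    exact ⟨c, hc, hb.trans ha⟩
  refine ⟨⟨0, le_rfl, by simp⟩, fun a ha b hb => hsolid _ (hadd a ha b hb) _ ?_, ?_,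
    fun a ha => hsolid a ha _ (abs_neg a).le, fun a ha b hb => hsolid _ (hadd a ha b hb) _ ?_,
    fun a ha b hb => hsolid _ (hadd a ha b hb) _ ?_⟩
  · exact (abs_add_le a b).trans (le_abs_self _)
  · rintro c a ⟨d, hd, ha⟩
    refine ⟨|c| * d, mul_nonneg (abs_nonneg c) hd, (abs_real_smul_le c a).trans ?_⟩
    rw [← smul_smul]
    exact smul_le_smul_of_nonneg_left ha (abs_nonneg c)
  · refine le_trans ?_ (le_abs_self _)
    simpa using abs_sup_sub_sup_le_add a b 0 0
  · refine le_trans ?_ (le_abs_self _)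
    rw [← abs_neg, neg_inf]
    simpa using abs_sup_sub_sup_le_add (-a) (-b) 0 0

theorem IsSublatticeSet.sub_mem {Z : Set X} (hZ : IsSublatticeSet Z) {a b : X} (ha : a ∈ Z)
    (hb : b ∈ Z) : a - b ∈ Z := by
  rw [sub_eq_add_neg]
  exact hZ.2.1 a ha _ (hZ.2.2.2.1 b hb)

theorem isSublatticeSet_sInter {n : ℕ} (x : Fin n → X) :
    IsSublatticeSet (⋂₀ {Z : Set X | IsSublatticeSet Z ∧ ∀ i, x i ∈ Z}) :=
  ⟨fun _ hZ => hZ.1.1, fun a ha b hb Z hZ => hZ.1.2.1 a (ha Z hZ) b (hb Z hZ),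
    fun c a ha Z hZ => hZ.1.2.2.1 c a (ha Z hZ), fun a ha Z hZ => hZ.1.2.2.2.1 a (ha Z hZ),
    fun a ha b hb Z hZ => hZ.1.2.2.2.2.1 a (ha Z hZ) b (hb Z hZ),
    fun a ha b hb Z hZ => hZ.1.2.2.2.2.2 a (ha Z hZ) b (hb Z hZ)⟩

theorem idealSet_subset_growthSet (f : X) (k : ℕ) : idealSet (f ^ k) ⊆ growthSet f := by
  rintro y ⟨c, hc, hy⟩
  exact ⟨c, k, hc, hy⟩

end RegularNorm

section Calculus

variable {X : Type*} [Lattice X] [Ring X] [IsOrderedRing X] [Module ℝ X] [IsOrderedModule ℝ X]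
  [IsScalarTower ℝ X X] [SMulCommClass ℝ X X]

/-- Coordinatewise truncation of a vector to the cube `[-R, R]ⁿ`. -/
def clampCube {n : ℕ} (R : ℝ) (hR : 0 ≤ R) (t : Fin n → ℝ) :
    Set.Icc (fun _ : Fin n => -R) (fun _ => R) :=
  ⟨fun i => (t i ⊓ R) ⊔ (-R), fun _ => le_sup_right,
    fun _ => sup_le inf_le_right (by linarith)⟩

/-- Uniform approximation of a continuous function on a cube by elements of a sublattice
containing the unit and the generators. -/
theorem exists_approx_cube {n : ℕ} {x : Fin n → X} {f : X} (hf : 1 ≤ f) {Z : Set X}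
    (hZ : IsSublatticeSet Z) (h1 : (1 : X) ∈ Z) (hx : ∀ i, x i ∈ Z) (hZf : Z ⊆ growthSet f)
    {u : (Fin n → ℝ) → ℝ} (hu : Continuous u) (R : ℝ) (hR : 0 ≤ R) {ε : ℝ} (hε : 0 < ε) :
    ∃ z ∈ Z, ∀ ω : X → ℝ, IsCharOn f ω →
      |ω z - u (clampCube R hR fun i => ω (x i))| ≤ ε := by
  obtain ⟨-, hadd, hsmul, hneg, hsup, hinf⟩ := hZ
  set K : Set (Fin n → ℝ) := Set.Icc (fun _ => -R) (fun _ => R)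
  let L : Set C(K, ℝ) := {q | ∃ z ∈ Z, ∀ ω : X → ℝ, IsCharOn f ω →
    ω z = q (clampCube R hR fun i => ω (x i))}
  have haff : ∀ (a b : ℝ) (i : Fin n), ∃ q ∈ L, ∀ t : K, q t = a + b * t.1 i := by
    intro a b i
    refine ⟨⟨fun t => a + b * t.1 i, continuous_const.add
      (continuous_const.mul ((continuous_apply i).comp continuous_subtype_val))⟩,
      ⟨a • 1 + b • ((x i ⊓ R • 1) ⊔ (-R) • 1),
      hadd _ (hsmul _ _ h1) _ (hsmul _ _ (hsup _ (hinf _ (hx i) _ (hsmul _ _ h1)) _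
        (hsmul _ _ h1))), fun ω hω => ?_⟩, fun t => rfl⟩
    have m1 := one_mem_growthSet f
    have mi : x i ⊓ R • 1 ∈ Z := hinf _ (hx i) _ (hsmul _ _ h1)
    have ms : x i ⊓ R • 1 ⊔ (-R) • 1 ∈ Z := hsup _ mi _ (hsmul _ _ h1)
    rw [hω.map_add (growthSet_smul _ m1) (growthSet_smul _ (hZf ms)),
      hω.map_smul _ m1, hω.map_smul _ (hZf ms), hω.map_sup (hZf mi) (growthSet_smul _ m1),
      hω.map_inf hf (hZf (hx i)) (growthSet_smul _ m1), hω.map_smul _ m1, hω.map_smul _ m1,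
      hω.one, mul_one, mul_one, mul_one]
    rfl
  have hconst : ∀ a : ℝ, ∃ q ∈ L, ∀ t : K, q t = a := by
    intro a
    refine ⟨⟨fun t => a, by fun_prop⟩, ⟨a • 1, hsmul _ _ h1, fun ω hω => ?_⟩, fun t => rfl⟩
    rw [hω.map_smul _ (one_mem_growthSet f), hω.one, mul_one]
    rfl
  have hdense : closure L = ⊤ := by
    refine ContinuousMap.sublattice_closure_eq_top L ?_ ?_ ?_ ?_
    · obtain ⟨q, hq, -⟩ := hconst 0
      exact ⟨q, hq⟩
    · rintro p ⟨y, hy, hp⟩ q ⟨z, hz, hq⟩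
      refine ⟨y ⊓ z, hinf y hy z hz, fun ω hω => ?_⟩
      rw [hω.map_inf hf (hZf hy) (hZf hz), hp ω hω, hq ω hω]
      rfl
    · rintro p ⟨y, hy, hp⟩ q ⟨z, hz, hq⟩
      refine ⟨y ⊔ z, hsup y hy z hz, fun ω hω => ?_⟩
      rw [hω.map_sup (hZf hy) (hZf hz), hp ω hω, hq ω hω]
      rfl
    · intro v s t
      by_cases hst : s = t
      · obtain ⟨q, hq, h⟩ := hconst (v s)
        exact ⟨q, hq, h s, by rw [h t, hst]⟩
      · obtain ⟨i, hi⟩ : ∃ i, s.1 i ≠ t.1 i := by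
          by_contra! hcon
          exact hst (Subtype.ext (funext hcon))
        obtain ⟨q, hq, h⟩ := haff (v s - (v s - v t) / (s.1 i - t.1 i) * s.1 i)
          ((v s - v t) / (s.1 i - t.1 i)) i
        have hne := sub_ne_zero.2 hi
        refine ⟨q, hq, by rw [h s]; ring, ?_⟩
        rw [h t]
        field_simp
        ring
  have hmem : (⟨fun t => u t.1, by fun_prop⟩ : C(K, ℝ)) ∈ closure L := by rw [hdense]; trivial
  obtain ⟨q, ⟨z, hz, hq⟩, hdist⟩ := Metric.mem_closure_iff.1 hmem ε hε
  refine ⟨z, hz, fun ω hω => ?_⟩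
  rw [hq ω hω, ← Real.dist_eq, dist_comm]
  exact (ContinuousMap.dist_apply_le_dist (clampCube R hR fun i => ω (x i))).trans hdist.le

/-- A polynomially growing function is approximated, relative to a power of `f`, by elements of a
sublattice containing the unit and the generators. -/
theorem exists_approx_growth {n : ℕ} {x : Fin n → X} {f : X} (hf : 1 ≤ f) (hxf : ∀ i, |x i| ≤ f)
    {Z : Set X} (hZ : IsSublatticeSet Z) (h1 : (1 : X) ∈ Z) (hx : ∀ i, x i ∈ Z)
    (hZf : Z ⊆ growthSet f) {u : (Fin n → ℝ) → ℝ} (hu : Continuous u) {M : ℝ} {N : ℕ}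
    (hM : 0 ≤ M) (hb : ∀ t : Fin n → ℝ, |u t| ≤ M * (1 + ∑ i : Fin n, |t i|) ^ N)
    {ε : ℝ} (hε : 0 < ε) :
    ∃ z ∈ Z, ∀ ω : X → ℝ, IsCharOn f ω →
      |ω z - u (fun i => ω (x i))| ≤ ε * ω f ^ (N + 1) := by
  set M' : ℝ := M * (1 + n) ^ N
  have hM' : 0 ≤ M' := by positivity
  set R : ℝ := 4 * M' / ε
  have hR : 0 ≤ R := by positivity
  obtain ⟨z, hz, happ⟩ := exists_approx_cube hf hZ h1 hx hZf hu R hR (half_pos hε)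
  refine ⟨z, hz, fun ω hω => ?_⟩
  have hfm := self_mem_growthSet hf
  have hs1 : 1 ≤ ω f := by rw [← hω.one]; exact hω.map_mono (one_mem_growthSet f) hfm hf
  have hs0 : 0 < ω f := by linarith
  set s := ω f
  set t : Fin n → ℝ := fun i => ω (x i)
  have ht : ∀ i, |t i| ≤ s := fun i => by
    have := hω.map_mono (growthSet_abs (hZf (hx i))) hfm (hxf i)
    rwa [hω.map_abs (hZf (hx i))] at this
  have hbound : ∀ v : Fin n → ℝ, (∀ i, |v i| ≤ s) → |u v| ≤ M' * s ^ N := by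
    intro v hv
    refine (hb v).trans ?_
    have h2 : 1 + ∑ i : Fin n, |v i| ≤ (1 + n) * s := by
      have : ∑ i : Fin n, |v i| ≤ ∑ _i : Fin n, s := Finset.sum_le_sum fun i _ => hv i
      simp only [Finset.sum_const, Finset.card_univ, Fintype.card_fin, nsmul_eq_mul] at this
      linarith
    have h0 : 0 ≤ 1 + ∑ i : Fin n, |v i| := by positivity
    calc M * (1 + ∑ i : Fin n, |v i|) ^ N ≤ M * ((1 + n) * s) ^ N := by gcongr
      _ = M' * s ^ N := by rw [mul_pow]; ring
  have htail : |u (clampCube R hR t) - u t| ≤ ε / 2 * s ^ (N + 1) := by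
    by_cases hin : ∀ i, |t i| ≤ R
    · have : ((clampCube R hR t : _) : Fin n → ℝ) = t := by
        funext i
        have := abs_le.1 (hin i)
        simp only [clampCube]
        rw [inf_eq_left.2 this.2, sup_eq_left.2 this.1]
      rw [this, sub_self, abs_zero]
      positivity
    · push Not at hin
      obtain ⟨i, hi⟩ := hin
      have hRs : R ≤ s := hi.le.trans (ht i)
      have hc : ∀ j, |(clampCube R hR t).1 j| ≤ s := fun j => by
        have h3 := (clampCube R hR t).2
        exact (abs_le.2 ⟨h3.1 j, h3.2 j⟩).trans hRs
      have h4 : 2 * M' = ε / 2 * R := by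
        simp only [R]; field_simp; ring
      calc |u (clampCube R hR t) - u t| ≤ |u (clampCube R hR t)| + |u t| := abs_sub _ _
        _ ≤ M' * s ^ N + M' * s ^ N := add_le_add (hbound _ hc) (hbound t ht)
        _ = ε / 2 * (R * s ^ N) := by linear_combination s ^ N * h4
        _ ≤ ε / 2 * (s * s ^ N) := by gcongr
        _ = _ := by rw [pow_succ']
  have hone : ε / 2 ≤ ε / 2 * s ^ (N + 1) := le_mul_of_one_le_right (by linarith) (one_le_pow₀ hs1)
  calc |ω z - u t| ≤ |ω z - u (clampCube R hR t)| + |u (clampCube R hR t) - u t| :=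
        abs_sub_le _ _ _
    _ ≤ ε / 2 * s ^ (N + 1) + ε / 2 * s ^ (N + 1) := add_le_add ((happ ω hω).trans hone) htail
    _ = _ := by ring

/-- Under the completeness hypothesis every polynomially growing function is represented by an
element of the algebra. -/
theorem exists_represents
    (hF : ∀ a b z : X, a ⊓ b = 0 → 0 ≤ z → (z * a) ⊓ b = 0 ∧ (a * z) ⊓ b = 0)
    (harch : ∀ y z : X, 0 ≤ y → 0 ≤ z → (∀ k : ℕ, k • y ≤ z) → y = 0)
    {n : ℕ} {x : Fin n → X} {f : X} (hf : 1 ≤ f) (hxf : ∀ i, |x i| ≤ f)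
    {Z : Set X} (hZ : IsSublatticeSet Z) (h1 : (1 : X) ∈ Z) (hx : ∀ i, x i ∈ Z)
    (hZf : Z ⊆ idealSet f)
    (hcomp : ∀ m : ℕ, NormComplete (f ^ (m + 1)) {y : X | y ∈ idealSet (f ^ (m + 1)) ∧
      ∀ ε : ℝ, 0 < ε → ∃ z ∈ Z, regNorm (f ^ (m + 1)) (y - z) < ε})
    {u : (Fin n → ℝ) → ℝ} (hu : PolyGrowth n u) :
    ∃ y ∈ growthSet f, ∀ ω : X → ℝ, IsCharOn f ω → ω y = u fun i => ω (x i) := by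
  obtain ⟨hcont, M, N, hM, hb⟩ := hu
  have hf0 : 0 ≤ f := zero_le_one.trans hf
  have he : 0 ≤ f ^ (N + 1) := pow_nonneg hf0 _
  have hfe : f ≤ f ^ (N + 1) := le_self_pow₀ hf (by omega)
  have hZe : Z ⊆ idealSet (f ^ (N + 1)) := fun z hz => by
    obtain ⟨c, hc, h⟩ := hZf hz
    exact ⟨c, hc, h.trans (smul_le_smul_of_nonneg_left hfe hc)⟩
  have hZg : Z ⊆ growthSet f := hZe.trans (idealSet_subset_growthSet f _)
  have hfm := self_mem_growthSet hf
  have hem : f ^ (N + 1) ∈ growthSet f := growthSet_pow hfm _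
  have hpos : ∀ k : ℕ, (0 : ℝ) < 1 / (k + 1) := fun k => by positivity
  choose z hz happ using fun k : ℕ =>
    exists_approx_growth hf hxf hZ h1 hx hZg hcont hM hb (hpos k)
  have hI := isSublatticeSet_idealSet (f ^ (N + 1))
  obtain ⟨y, ⟨hyI, -⟩, hlim⟩ := hcomp N z (fun k => ⟨hZe (hz k), fun ε hε => ⟨z k, hz k, by
      rw [sub_self]
      exact (regNorm_le le_rfl (by simp)).trans_lt hε⟩⟩) (by
    intro ε hε
    obtain ⟨K, hK⟩ := exists_nat_one_div_lt (show 0 < ε / 3 by linarith)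
    refine ⟨K, fun p q hp hq => ?_⟩
    have hpm := hZg (hz p)
    have hqm := hZg (hz q)
    have hle : |z p - z q| ≤ (2 * (ε / 3)) • f ^ (N + 1) := by
      refine le_of_forall_char hF harch hf (growthSet_abs (growthSet_sub hf hpm hqm))
        (growthSet_smul _ hem) fun ω hω => ?_
      rw [hω.map_abs (growthSet_sub hf hpm hqm), hω.map_sub hpm hqm, hω.map_smul _ hem,
        hω.map_pow hfm]
      have hs1 : 1 ≤ ω f := by rw [← hω.one]; exact hω.map_mono (one_mem_growthSet f) hfm hf
      have hs0 : 0 ≤ ω f ^ (N + 1) := pow_nonneg (by linarith) _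
      have hd : ∀ r : ℕ, K ≤ r → (1 : ℝ) / (r + 1) ≤ ε / 3 := fun r hr =>
        (Nat.one_div_le_one_div hr).trans hK.le
      have h2 := (happ p ω hω).trans (mul_le_mul_of_nonneg_right (hd p hp) hs0)
      have h3 := (happ q ω hω).trans (mul_le_mul_of_nonneg_right (hd q hq) hs0)
      rw [abs_sub_comm] at h3
      have := abs_sub_le (ω (z p)) (u fun i => ω (x i)) (ω (z q))
      linarith
    exact (regNorm_le (by linarith) hle).trans_lt (by linarith))
  have hym := idealSet_subset_growthSet f _ hyI
  refine ⟨y, hym, fun ω hω => ?_⟩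
  have hs1 : 1 ≤ ω f := by rw [← hω.one]; exact hω.map_mono (one_mem_growthSet f) hfm hf
  have hs0 : 0 < ω f ^ (N + 1) := pow_pos (by linarith) _
  refine eq_of_abs_sub_le_all fun δ hδ => ?_
  set ε := δ / (2 * ω f ^ (N + 1)) with hεdef
  have hε : 0 < ε := by positivity
  obtain ⟨K, hK⟩ := hlim ε hε
  obtain ⟨K', hK'⟩ := exists_nat_one_div_lt hε
  set p := max K K'
  have hpm := hZg (hz p)
  have h2 : |z p - y| ≤ ε • f ^ (N + 1) :=
    abs_le_of_regNorm_lt he (hI.sub_mem (hZe (hz p)) hyI) (hK p (le_max_left _ _))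
  have h3 := hω.map_mono (growthSet_abs (growthSet_sub hf hpm hym)) (growthSet_smul _ hem) h2
  rw [hω.map_abs (growthSet_sub hf hpm hym), hω.map_sub hpm hym, hω.map_smul _ hem,
    hω.map_pow hfm, abs_sub_comm] at h3
  have h4 := (happ p ω hω).trans (mul_le_mul_of_nonneg_right
    ((Nat.one_div_le_one_div (le_max_right K K')).trans hK'.le) hs0.le)
  have h5 : 2 * (ε * ω f ^ (N + 1)) = δ := by rw [hεdef]; field_simp
  have := abs_sub_le (ω y) (ω (z p)) (u fun i => ω (x i))
  linarith

end Calculus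

section Existence

variable {X : Type*} [Lattice X] [Ring X] [Module ℝ X]

/-- In an `f`-ring the identity is positive. -/
theorem one_nonneg_of_fAlgebra [IsOrderedAddMonoid X]
    (hmulpos : ∀ y z : X, 0 ≤ y → 0 ≤ z → 0 ≤ y * z)
    (hF : ∀ a b z : X, a ⊓ b = 0 → 0 ≤ z → (z * a) ⊓ b = 0 ∧ (a * z) ⊓ b = 0) : (0 : X) ≤ 1 := by
  have hp := posPart_nonneg (1 : X)
  have hn := negPart_nonneg (1 : X)
  have hd := posPart_inf_negPart_eq_zero (1 : X)
  have h1 : (1 : X)⁻ * 1⁺ = 0 := by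
    have h := (hF _ _ _ (by rw [inf_comm]; exact (hF _ _ _ hd hn).1) hp).2
    rwa [inf_idem] at h
  have h2 : (1 : X)⁺ * 1⁻ = 0 := by
    have h := (hF _ _ _ (by rw [inf_comm]; exact (hF _ _ _ hd hn).2) hp).1
    rwa [inf_idem] at h
  have h3 : (1 : X) = 1⁺ * 1⁺ + 1⁻ * 1⁻ := by
    have h := posPart_sub_negPart (1 : X)
    calc (1 : X) = (1⁺ - 1⁻) * (1⁺ - 1⁻) := by rw [h, mul_one]
      _ = _ := by rw [sub_mul, mul_sub, mul_sub, h1, h2]; abel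
  rw [h3]
  exact add_nonneg (hmulpos _ _ hp hp) (hmulpos _ _ hn hn)

theorem sup_abs_le_iff {n : ℕ} {x : Fin n → X} {f : X} :
    (Finset.univ.fold (β := X) (· ⊔ ·) 1 fun i => |x i|) ≤ f ↔ 1 ≤ f ∧ ∀ i, |x i| ≤ f := by
  have h := Finset.fold_op_rel_iff_and (op := ((· ⊔ ·) : X → X → X)) (r := fun a b : X => b ≤ a)
    (f := fun i => |x i|) (b := 1) (s := Finset.univ) (fun {_ _ _} => sup_le_iff) (c := f)
  simpa using h

end Existence

section Calculus

variable {X : Type*} [Lattice X] [Ring X] [IsOrderedRing X] [Module ℝ X] [IsOrderedModule ℝ X]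
  [IsScalarTower ℝ X X] [SMulCommClass ℝ X X]

theorem exists_polyGrowth_calculus
    (hF : ∀ a b z : X, a ⊓ b = 0 → 0 ≤ z → (z * a) ⊓ b = 0 ∧ (a * z) ⊓ b = 0)
    (harch : ∀ y z : X, 0 ≤ y → 0 ≤ z → (∀ k : ℕ, k • y ≤ z) → y = 0)
    {n : ℕ} {x : Fin n → X} {f : X} (hf : 1 ≤ f) (hxf : ∀ i, |x i| ≤ f)
    {Z : Set X} (hZ : IsSublatticeSet Z) (h1 : (1 : X) ∈ Z) (hx : ∀ i, x i ∈ Z)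
    (hZf : Z ⊆ idealSet f)
    (hcomp : ∀ m : ℕ, NormComplete (f ^ (m + 1)) {y : X | y ∈ idealSet (f ^ (m + 1)) ∧
      ∀ ε : ℝ, 0 < ε → ∃ z ∈ Z, regNorm (f ^ (m + 1)) (y - z) < ε}) :
    ∃ Ψ : ∀ f : (Fin n → ℝ) → ℝ, PolyGrowth n f → X,
      IsLatAlgHom (PolyGrowth n) Ψ ∧ (∀ h1 : PolyGrowth n 1, Ψ 1 h1 = 1) ∧
      ∀ (i : Fin n) (hi : PolyGrowth n fun t => t i), Ψ (fun t => t i) hi = x i := by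
  choose Ψ hΨ hω using fun (u : (Fin n → ℝ) → ℝ) (hu : PolyGrowth n u) =>
    exists_represents hF harch hf hxf hZ h1 hx hZf hcomp hu
  have hxm : ∀ i, x i ∈ growthSet f := fun i => by
    have := idealSet_subset_growthSet f 1
    rw [pow_one] at this
    exact this (hZf (hx i))
  refine ⟨Ψ, ⟨⟨fun u v hu hv huv => ?_, fun c u hu hcu => ?_, fun u v hu hv huv => ?_⟩,
    fun u v hu hv huv => ?_⟩, fun h => ?_, fun i hi => ?_⟩
  · refine eq_of_forall_char hF harch hf (hΨ _ _) (growthSet_add hf (hΨ _ _) (hΨ _ _)) fun ω h => ?_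
    rw [h.map_add (hΨ _ _) (hΨ _ _), hω _ _ _ h, hω _ _ _ h, hω _ _ _ h]
    rfl
  · refine eq_of_forall_char hF harch hf (hΨ _ _) (growthSet_smul _ (hΨ _ _)) fun ω h => ?_
    rw [h.map_smul _ (hΨ _ _), hω _ _ _ h, hω _ _ _ h]
    rfl
  · refine eq_of_forall_char hF harch hf (hΨ _ _) (growthSet_sup hf (hΨ _ _) (hΨ _ _)) fun ω h => ?_
    rw [h.map_sup (hΨ _ _) (hΨ _ _), hω _ _ _ h, hω _ _ _ h, hω _ _ _ h]
    rfl
  · refine eq_of_forall_char hF harch hf (hΨ _ _) (growthSet_mul (hΨ _ _) (hΨ _ _)) fun ω h => ?_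
    rw [h.map_mul (hΨ _ _) (hΨ _ _), hω _ _ _ h, hω _ _ _ h, hω _ _ _ h]
    rfl
  · refine eq_of_forall_char hF harch hf (hΨ _ _) (one_mem_growthSet f) fun ω h' => ?_
    rw [hω _ _ _ h', h'.one]
    rfl
  · refine eq_of_forall_char hF harch hf (hΨ _ _) (hxm i) fun ω h => ?_
    rw [hω _ _ _ h]

end Calculus

section PolyGrowthClosure

variable {n : ℕ} {u v : (Fin n → ℝ) → ℝ}

theorem one_le_one_add_sum_abs (t : Fin n → ℝ) : 1 ≤ 1 + ∑ i : Fin n, |t i| :=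
  le_add_of_nonneg_right (Finset.sum_nonneg fun _ _ => abs_nonneg _)

theorem PolyGrowth.of_abs_le (hu : Continuous u) (hv : PolyGrowth n v)
    (h : ∀ t, |u t| ≤ |v t|) : PolyGrowth n u := by
  obtain ⟨-, M, N, hM, hb⟩ := hv
  exact ⟨hu, M, N, hM, fun t => (h t).trans (hb t)⟩

theorem PolyGrowth.abs_add_abs (hu : PolyGrowth n u) (hv : PolyGrowth n v) :
    PolyGrowth n fun t => |u t| + |v t| := by
  obtain ⟨hcu, M, N, hM, hb⟩ := hu
  obtain ⟨hcv, M', N', hM', hb'⟩ := hv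
  refine ⟨hcu.abs.add hcv.abs, M + M', N + N', add_nonneg hM hM', fun t => ?_⟩
  have h1 := one_le_one_add_sum_abs t
  rw [abs_of_nonneg (add_nonneg (abs_nonneg _) (abs_nonneg _)), add_mul]
  refine add_le_add ((hb t).trans ?_) ((hb' t).trans ?_)
  · exact mul_le_mul_of_nonneg_left (pow_le_pow_right₀ h1 (by omega)) hM
  · exact mul_le_mul_of_nonneg_left (pow_le_pow_right₀ h1 (by omega)) hM'

theorem PolyGrowth.add (hu : PolyGrowth n u) (hv : PolyGrowth n v) : PolyGrowth n (u + v) :=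
  .of_abs_le (hu.1.add hv.1) (hu.abs_add_abs hv) fun _ => (abs_add_le _ _).trans (le_abs_self _)

theorem PolyGrowth.mul (hu : PolyGrowth n u) (hv : PolyGrowth n v) : PolyGrowth n (u * v) := by
  obtain ⟨hcu, M, N, hM, hb⟩ := hu
  obtain ⟨hcv, M', N', hM', hb'⟩ := hv
  refine ⟨hcu.mul hcv, M * M', N + N', mul_nonneg hM hM', fun t => ?_⟩
  rw [Pi.mul_apply, abs_mul, pow_add, mul_mul_mul_comm]
  exact mul_le_mul (hb t) (hb' t) (abs_nonneg _) ((abs_nonneg _).trans (hb t))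

theorem polyGrowth_const (n : ℕ) (c : ℝ) : PolyGrowth n fun _ => c :=
  ⟨continuous_const, |c|, 0, abs_nonneg c, fun t => by simp⟩

theorem PolyGrowth.smul (c : ℝ) (hu : PolyGrowth n u) : PolyGrowth n (c • u) :=
  (polyGrowth_const n c).mul hu

theorem PolyGrowth.neg (hu : PolyGrowth n u) : PolyGrowth n (-u) :=
  .of_abs_le hu.1.neg hu fun _ => (abs_neg _).le

theorem PolyGrowth.sub (hu : PolyGrowth n u) (hv : PolyGrowth n v) : PolyGrowth n (u - v) := by
  rw [sub_eq_add_neg]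
  exact hu.add hv.neg

theorem PolyGrowth.sup (hu : PolyGrowth n u) (hv : PolyGrowth n v) : PolyGrowth n (u ⊔ v) :=
  .of_abs_le (hu.1.sup hv.1) (hu.abs_add_abs hv) fun t => by
    refine (abs_max_le_max_abs_abs.trans ?_).trans (le_abs_self _)
    exact max_le_add_of_nonneg (abs_nonneg _) (abs_nonneg _)

theorem PolyGrowth.inf (hu : PolyGrowth n u) (hv : PolyGrowth n v) : PolyGrowth n (u ⊓ v) := by
  rw [← neg_neg (u ⊓ v), neg_inf]
  exact (hu.neg.sup hv.neg).neg

theorem PolyGrowth.abs (hu : PolyGrowth n u) : PolyGrowth n |u| :=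
  hu.sup hu.neg

theorem PolyGrowth.pow (hu : PolyGrowth n u) (k : ℕ) : PolyGrowth n (u ^ k) := by
  induction k with
  | zero => rw [pow_zero]; exact polyGrowth_const n 1
  | succ k ih => rw [pow_succ]; exact ih.mul hu

theorem polyGrowth_one_add_sum_abs (n : ℕ) :
    PolyGrowth n fun t => 1 + ∑ i : Fin n, |t i| :=
  ⟨by fun_prop, 1, 1, zero_le_one, fun t => by
    rw [abs_of_nonneg (zero_le_one.trans (one_le_one_add_sum_abs t)), one_mul, pow_one]⟩

theorem polyGrowth_apply (i : Fin n) : PolyGrowth n fun t => t i :=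
  .of_abs_le (continuous_apply i) (polyGrowth_one_add_sum_abs n) fun t => by
    refine le_trans ?_ (le_abs_self _)
    have := Finset.single_le_sum (f := fun j => |t j|) (fun _ _ => abs_nonneg _)
      (Finset.mem_univ i)
    linarith

/-- A sequence of continuous functions whose increments are geometrically small relative to a
positive continuous weight converges to a continuous function. -/
theorem exists_continuous_limit {S : Type*} [TopologicalSpace S] {Φ : S → ℝ} (hΦ : Continuous Φ)
    (hpos : ∀ t, 0 < Φ t) {g : ℕ → S → ℝ} (hg : ∀ k, Continuous (g k)) {C : ℝ}
    (h : ∀ k t, |g k t - g (k + 1) t| ≤ C / 2 / 2 ^ k * Φ t) :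
    ∃ G : S → ℝ, Continuous G ∧ ∀ k t, |g k t - G t| ≤ C / 2 ^ k * Φ t := by
  have hd : ∀ t k, dist (g k t / Φ t) (g (k + 1) t / Φ t) ≤ C / 2 / 2 ^ k := fun t k => by
    rw [Real.dist_eq, ← sub_div, abs_div, abs_of_pos (hpos t), div_le_iff₀ (hpos t)]
    exact h k t
  choose H hH using fun t => cauchySeq_tendsto_of_complete (cauchySeq_of_le_geometric_two (hd t))
  have hle : ∀ k t, dist (g k t / Φ t) (H t) ≤ C / 2 ^ k := fun k t =>
    dist_le_of_le_geometric_two_of_tendsto (hd t) (hH t) k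
  have hcont : Continuous H := by
    have hu : TendstoUniformly (fun k t => g k t / Φ t) H Filter.atTop := by
      rw [Metric.tendstoUniformly_iff]
      intro ε hε
      have h0 : Filter.Tendsto (fun k : ℕ => C / 2 ^ k) Filter.atTop (nhds 0) := by
        simpa [div_eq_mul_inv] using (tendsto_pow_atTop_nhds_zero_of_lt_one (r := (2 : ℝ)⁻¹)
          (by norm_num) (by norm_num)).const_mul C
      filter_upwards [h0.eventually (gt_mem_nhds hε)] with k hk t
      rw [dist_comm]
      exact (hle k t).trans_lt hk
    exact hu.continuous (Filter.Frequently.of_forall fun k =>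
      (hg k).div hΦ fun t => (hpos t).ne')
  refine ⟨fun t => H t * Φ t, hcont.mul hΦ, fun k t => ?_⟩
  have := hle k t
  have hp := hpos t
  rw [Real.dist_eq] at this
  calc |g k t - H t * Φ t| = |g k t / Φ t - H t| * Φ t := by
        rw [← abs_of_pos hp, ← abs_mul, abs_of_pos hp, sub_mul, div_mul_cancel₀ _ hp.ne']
    _ ≤ _ := mul_le_mul_of_nonneg_right this hp.le

end PolyGrowthClosure

section Homomorphism

variable {X : Type*} [Lattice X] [Ring X] [IsOrderedAddMonoid X] [Module ℝ X] {n : ℕ}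
  {T : ((Fin n → ℝ) → ℝ) → X} {u v : (Fin n → ℝ) → ℝ}

/-- A partially defined homomorphism on `PG_n` extends by zero to all functions. -/
theorem exists_isLatAlgHomOn {Ψ : ∀ f : (Fin n → ℝ) → ℝ, PolyGrowth n f → X}
    (hΨ : IsLatAlgHom (PolyGrowth n) Ψ) :
    ∃ T : ((Fin n → ℝ) → ℝ) → X, IsLatAlgHomOn {u | PolyGrowth n u} T ∧
      ∀ u hu, T u = Ψ u hu := by
  classical
  obtain ⟨⟨hadd, hsmul, hsup⟩, hmul⟩ := hΨ
  obtain ⟨T, hT⟩ : ∃ T : ((Fin n → ℝ) → ℝ) → X, ∀ u (hu : PolyGrowth n u), T u = Ψ u hu :=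
    ⟨fun u => if h : PolyGrowth n u then Ψ u h else 0, fun u hu => dif_pos hu⟩
  refine ⟨T, ⟨?_, ?_, ?_, ?_⟩, hT⟩
  · intro u (hu : PolyGrowth n u) v (hv : PolyGrowth n v)
    rw [hT u hu, hT v hv, hT _ (hu.add hv), hadd]
  · intro c u (hu : PolyGrowth n u)
    rw [hT u hu, hT _ (hu.smul c), hsmul]
  · intro u (hu : PolyGrowth n u) v (hv : PolyGrowth n v)
    rw [hT u hu, hT v hv, hT _ (hu.sup hv), hsup]
  · intro u (hu : PolyGrowth n u) v (hv : PolyGrowth n v)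
    rw [hT u hu, hT v hv, hT _ (hu.mul hv), hmul]

namespace IsLatAlgHomOn

theorem map_mono (hT : IsLatAlgHomOn {u | PolyGrowth n u} T) (hu : PolyGrowth n u)
    (hv : PolyGrowth n v) (h : u ≤ v) : T u ≤ T v := by
  rw [← sup_eq_right.2 h, hT.2.2.1 u hu v hv]
  exact le_sup_left

theorem map_neg (hT : IsLatAlgHomOn {u | PolyGrowth n u} T) (hu : PolyGrowth n u) :
    T (-u) = -T u := by
  rw [← neg_one_smul ℝ u, hT.2.1 _ u hu, neg_one_smul]

theorem map_sub (hT : IsLatAlgHomOn {u | PolyGrowth n u} T) (hu : PolyGrowth n u)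
    (hv : PolyGrowth n v) : T (u - v) = T u - T v := by
  rw [sub_eq_add_neg, hT.1 u hu _ hv.neg, hT.map_neg hv, sub_eq_add_neg]

theorem map_inf (hT : IsLatAlgHomOn {u | PolyGrowth n u} T) (hu : PolyGrowth n u)
    (hv : PolyGrowth n v) : T (u ⊓ v) = T u ⊓ T v := by
  rw [← neg_neg (u ⊓ v), neg_inf, hT.map_neg (hu.neg.sup hv.neg), hT.2.2.1 _ hu.neg _ hv.neg,
    hT.map_neg hu, hT.map_neg hv, neg_sup, neg_neg, neg_neg]

theorem map_abs (hT : IsLatAlgHomOn {u | PolyGrowth n u} T) (hu : PolyGrowth n u) :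
    T |u| = |T u| := by
  rw [abs, hT.2.2.1 u hu _ hu.neg, hT.map_neg hu, abs]

theorem map_zero (hT : IsLatAlgHomOn {u | PolyGrowth n u} T) : T 0 = 0 := by
  have h := hT.map_sub (polyGrowth_const n 0) (polyGrowth_const n 0)
  rwa [sub_self, sub_self] at h

theorem map_pow (hT : IsLatAlgHomOn {u | PolyGrowth n u} T) (h1 : T 1 = 1)
    (hu : PolyGrowth n u) (k : ℕ) : T (u ^ k) = T u ^ k := by
  induction k with
  | zero => rw [pow_zero, pow_zero, h1]
  | succ k ih => rw [pow_succ, pow_succ, hT.2.2.2 _ (hu.pow k) u hu, ih]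

theorem isSublatticeSet_image (hT : IsLatAlgHomOn {u | PolyGrowth n u} T) :
    IsSublatticeSet (T '' {u | PolyGrowth n u}) := by
  refine ⟨⟨0, polyGrowth_const n 0, hT.map_zero⟩, ?_, ?_, ?_, ?_, ?_⟩
  · rintro _ ⟨u, hu, rfl⟩ _ ⟨v, hv, rfl⟩
    exact ⟨u + v, hu.add hv, hT.1 u hu v hv⟩
  · rintro c _ ⟨u, hu, rfl⟩
    exact ⟨c • u, hu.smul c, hT.2.1 c u hu⟩
  · rintro _ ⟨u, hu, rfl⟩
    exact ⟨-u, hu.neg, hT.map_neg hu⟩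
  · rintro _ ⟨u, hu, rfl⟩ _ ⟨v, hv, rfl⟩
    exact ⟨u ⊔ v, hu.sup hv, hT.2.2.1 u hu v hv⟩
  · rintro _ ⟨u, hu, rfl⟩ _ ⟨v, hv, rfl⟩
    exact ⟨u ⊓ v, hu.inf hv, hT.map_inf hu hv⟩

end IsLatAlgHomOn

/-- A continuous function calculus in three variables forces the `f`-algebra property. -/
theorem fAlgebra_of_calculus (hmulpos : ∀ y z : X, 0 ≤ y → 0 ≤ z → 0 ≤ y * z) {a b z : X}
    {T : ((Fin 3 → ℝ) → ℝ) → X} (hT : IsLatAlgHomOn {u | PolyGrowth 3 u} T)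
    (hTa : T (fun t => t 0) = a) (hTb : T (fun t => t 1) = b) (hTz : T (fun t => t 2) = z)
    (hab : a ⊓ b = 0) (hz : 0 ≤ z) : (z * a) ⊓ b = 0 ∧ (a * z) ⊓ b = 0 := by
  have ha : 0 ≤ a := hab ▸ inf_le_left
  have hb : 0 ≤ b := hab ▸ inf_le_right
  have h0 : PolyGrowth 3 0 := polyGrowth_const 3 0
  have h1 : PolyGrowth 3 1 := polyGrowth_const 3 1
  let p : Fin 3 → (Fin 3 → ℝ) → ℝ := fun i t => t i
  have pos : ∀ i : Fin 3, PolyGrowth 3 (p i ⊔ 0) := fun i => (polyGrowth_apply i).sup h0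
  have hTpos : ∀ i : Fin 3, T (p i ⊔ 0) = T (p i) ⊔ 0 := fun i => by
    rw [hT.2.2.1 _ (polyGrowth_apply i) _ h0, hT.map_zero]
  have hTa' : T (p 0 ⊔ 0) = a := by rw [hTpos, hTa, sup_eq_left.2 ha]
  have hTb' : T (p 1 ⊔ 0) = b := by rw [hTpos, hTb, sup_eq_left.2 hb]
  have hTz' : T (p 2 ⊔ 0) = z := by rw [hTpos, hTz, sup_eq_left.2 hz]
  have hcomm : z * a = a * z := by
    have h := hT.2.2.2 _ (pos 2) _ (pos 0)
    rw [mul_comm, hT.2.2.2 _ (pos 0) _ (pos 2), hTa', hTz'] at h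
    exact h.symm
  have hle : (p 2 ⊔ 0) * (p 0 ⊔ 0) ⊓ (p 1 ⊔ 0) ≤ (p 2 ⊔ 1) * ((p 0 ⊔ 0) ⊓ (p 1 ⊔ 0)) := by
    intro t
    simp only [Pi.inf_apply, Pi.mul_apply, Pi.sup_apply, Pi.zero_apply, Pi.one_apply]
    have hp : 0 ≤ p 0 t ⊔ 0 := le_sup_right
    have hq : 0 ≤ p 1 t ⊔ 0 := le_sup_right
    have hr : 1 ≤ p 2 t ⊔ 1 := le_sup_right
    have hs : p 2 t ⊔ 0 ≤ p 2 t ⊔ 1 := sup_le_sup_left zero_le_one _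
    rw [mul_min_of_nonneg _ _ (zero_le_one.trans hr)]
    exact min_le_min (mul_le_mul_of_nonneg_right hs hp) (le_mul_of_one_le_left hq hr)
  have h := hT.map_mono (((pos 2).mul (pos 0)).inf (pos 1))
    (((polyGrowth_apply 2).sup h1).mul ((pos 0).inf (pos 1))) hle
  rw [hT.map_inf ((pos 2).mul (pos 0)) (pos 1), hT.2.2.2 _ (pos 2) _ (pos 0),
    hT.2.2.2 _ ((polyGrowth_apply 2).sup h1) _ ((pos 0).inf (pos 1)), hT.map_inf (pos 0) (pos 1),
    hTa', hTb', hTz', hab, mul_zero] at h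
  have hza := le_antisymm h (le_inf (hmulpos z a hz ha) hb)
  exact ⟨hza, hcomm ▸ hza⟩

end Homomorphism

section Completeness

variable {X : Type*} [Lattice X] [Ring X] [IsOrderedRing X] [Module ℝ X] [IsOrderedModule ℝ X]
  {n : ℕ} {T : ((Fin n → ℝ) → ℝ) → X}

/-- The image of a geometrically Cauchy sequence under a function calculus has a limit in the
image. -/
theorem IsLatAlgHomOn.exists_limit (hT : IsLatAlgHomOn {u | PolyGrowth n u} T)
    {Φ : (Fin n → ℝ) → ℝ} (hΦ : PolyGrowth n Φ) (hpos : ∀ t, 0 < Φ t) {z : ℕ → X}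
    (hz : ∀ k, z k ∈ T '' {u | PolyGrowth n u}) {C : ℝ} (hC : 0 ≤ C)
    (h : ∀ k, |z (k + 1) - z k| ≤ (C / 2 / 2 ^ k) • T Φ) :
    ∃ y : X, ∀ k, |z k - y| ≤ (C / 2 ^ k) • T Φ := by
  choose w hw hwz using hz
  replace hw : ∀ k, PolyGrowth n (w k) := hw
  set c : ℕ → ℝ := fun k => C / 2 / 2 ^ k
  have hc : ∀ k, 0 ≤ c k := fun k => by positivity
  let d : ℕ → (Fin n → ℝ) → ℝ := fun k => ((w (k + 1) - w k) ⊓ c k • Φ) ⊔ -(c k • Φ)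
  have hd : ∀ k, PolyGrowth n (d k) := fun k =>
    (((hw _).sub (hw k)).inf (hΦ.smul _)).sup (hΦ.smul _).neg
  have hTd : ∀ k, T (d k) = z (k + 1) - z k := fun k => by
    have hk := abs_le'.1 (h k)
    rw [hT.2.2.1 _ (((hw _).sub (hw k)).inf (hΦ.smul _)) _ (hΦ.smul _).neg,
      hT.map_inf ((hw _).sub (hw k)) (hΦ.smul _), hT.map_neg (hΦ.smul _), hT.2.1 _ _ hΦ,
      hT.map_sub (hw _) (hw k), hwz, hwz, inf_eq_left.2 hk.1, sup_eq_left.2 (neg_le.1 hk.2)]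
  let g : ℕ → (Fin n → ℝ) → ℝ := fun k => w 0 + ∑ j ∈ Finset.range k, d j
  have hsucc : ∀ k, g (k + 1) = g k + d k := fun k => by
    simp only [g, Finset.sum_range_succ, add_assoc]
  have hg : ∀ k, PolyGrowth n (g k) ∧ T (g k) = z k := fun k => by
    induction k with
    | zero => simpa [g] using ⟨hw 0, hwz 0⟩
    | succ k ih =>
      rw [hsucc]
      exact ⟨ih.1.add (hd k), by rw [hT.1 _ ih.1 _ (hd k), hTd, ih.2]; abel⟩
  obtain ⟨G, hG, hGle⟩ := exists_continuous_limit hΦ.1 hpos (g := g) (fun k => (hg k).1.1)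
    (C := C) fun k t => by
      have hcΦ : 0 ≤ c k * Φ t := mul_nonneg (hc k) (hpos t).le
      rw [hsucc, Pi.add_apply, sub_add_cancel_left, abs_neg]
      exact abs_le.2 ⟨le_sup_right, sup_le inf_le_right (neg_le_self hcΦ)⟩
  have hGp : PolyGrowth n G := by
    refine .of_abs_le hG ((hg 0).1.abs_add_abs (hΦ.smul C)) fun t => ?_
    refine le_trans ?_ (le_abs_self _)
    have h1 := hGle 0 t
    rw [pow_zero, div_one] at h1
    have h2 := abs_sub_abs_le_abs_sub (G t) (g 0 t)
    rw [abs_sub_comm] at h2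
    have h3 := le_abs_self ((C • Φ) t)
    simp only [Pi.smul_apply, smul_eq_mul] at h3 ⊢
    linarith
  refine ⟨T G, fun k => ?_⟩
  rw [← (hg k).2, ← hT.map_sub (hg k).1 hGp, ← hT.map_abs ((hg k).1.sub hGp), ← hT.2.1 _ _ hΦ]
  exact hT.map_mono ((hg k).1.sub hGp).abs (hΦ.smul _) (hGle k)

theorem IsLatAlgHomOn.normComplete (hT : IsLatAlgHomOn {u | PolyGrowth n u} T)
    {Φ : (Fin n → ℝ) → ℝ} (hΦ : PolyGrowth n Φ) (hpos : ∀ t, 0 < Φ t) {e : X} (he : T Φ = e)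
    {Z : Set X} (hZT : Z ⊆ T '' {u | PolyGrowth n u}) (hZe : Z ⊆ idealSet e) :
    NormComplete e {y : X | y ∈ idealSet e ∧ ∀ ε : ℝ, 0 < ε → ∃ z ∈ Z, regNorm e (y - z) < ε} := by
  have he0 : 0 ≤ e := by
    rw [← he, ← hT.map_zero]
    exact hT.map_mono (polyGrowth_const n 0) hΦ fun t => (hpos t).le
  have hI := isSublatticeSet_idealSet e
  have hgeo : ∀ ε : ℝ, 0 < ε → ∃ k : ℕ, 8 / 2 ^ k < ε := fun ε hε => by
    obtain ⟨k, hk⟩ := exists_pow_lt_of_lt_one (show 0 < ε / 8 by linarith)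
      (show (1 / 2 : ℝ) < 1 by norm_num)
    refine ⟨k, ?_⟩
    rw [one_div_pow, lt_div_iff₀ (by norm_num)] at hk
    rw [div_eq_mul_one_div]
    linarith
  intro y hy hcau
  have hp2 : ∀ k : ℕ, (0 : ℝ) < 1 / 2 ^ k := fun k => by positivity
  choose N hN using fun k : ℕ => hcau (1 / 2 ^ k) (hp2 k)
  have hN' : ∀ k p q, N k ≤ p → N k ≤ q → |y p - y q| ≤ (1 / 2 ^ k : ℝ) • e :=
    fun k p q hp hq => abs_le_of_regNorm_lt he0 (hI.sub_mem (hy p).1 (hy q).1) (hN k p q hp hq)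
  let r : ℕ → ℕ := fun k => ∑ j ∈ Finset.range (k + 1), N j
  have hr : ∀ k, N k ≤ r k := fun k =>
    Finset.single_le_sum (fun _ _ => Nat.zero_le _) (Finset.self_mem_range_succ k)
  have hr' : ∀ k, N k ≤ r (k + 1) := fun k =>
    Finset.single_le_sum (fun _ _ => Nat.zero_le _) (Finset.mem_range.2 (by omega))
  choose z hz hyz using fun k : ℕ => (hy (r k)).2 (1 / 2 ^ k) (hp2 k)
  have hyz' : ∀ k, |y (r k) - z k| ≤ (1 / 2 ^ k : ℝ) • e := fun k =>
    abs_le_of_regNorm_lt he0 (hI.sub_mem (hy _).1 (hZe (hz k))) (hyz k)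
  have hstep : ∀ k, |z (k + 1) - z k| ≤ (6 / 2 / 2 ^ k : ℝ) • T Φ := fun k => by
    rw [he]
    have h1 := hyz' (k + 1)
    rw [abs_sub_comm] at h1
    have h1' : (1 / 2 ^ (k + 1) : ℝ) • e ≤ (1 / 2 ^ k : ℝ) • e :=
      smul_le_smul_of_nonneg_right (one_div_le_one_div_of_le (by positivity)
        (pow_le_pow_right₀ one_le_two (Nat.le_succ k))) he0
    calc |z (k + 1) - z k|
        = |(z (k + 1) - y (r (k + 1))) + (y (r (k + 1)) - y (r k)) + (y (r k) - z k)| := by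
          congr 1; abel
      _ ≤ |z (k + 1) - y (r (k + 1))| + |y (r (k + 1)) - y (r k)| + |y (r k) - z k| :=
          (abs_add_le _ _).trans (add_le_add_left (abs_add_le _ _) _)
      _ ≤ (1 / 2 ^ k : ℝ) • e + (1 / 2 ^ k : ℝ) • e + (1 / 2 ^ k : ℝ) • e :=
          add_le_add (add_le_add (h1.trans h1') (hN' k _ _ (hr' k) (hr k))) (hyz' k)
      _ = _ := by rw [← add_smul, ← add_smul]; congr 1; ring
  obtain ⟨l, hl⟩ := hT.exists_limit hΦ hpos (fun k => hZT (hz k)) (by norm_num) hstep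
  rw [he] at hl
  have hlI : l ∈ idealSet e := by
    rw [← sub_sub_cancel (z 0) l]
    exact hI.sub_mem (hZe (hz 0)) ⟨_, by positivity, hl 0⟩
  refine ⟨l, ⟨hlI, fun ε hε => ?_⟩, fun ε hε => ?_⟩
  · obtain ⟨k, hk⟩ := hgeo ε hε
    refine ⟨z k, hz k, (regNorm_le (c := 6 / 2 ^ k) (by positivity) ?_).trans_lt
      (lt_of_le_of_lt ?_ hk)⟩
    · rw [abs_sub_comm]
      exact hl k
    · gcongr; norm_num
  · obtain ⟨k, hk⟩ := hgeo ε hε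
    refine ⟨N k, fun p hp => (regNorm_le (c := 8 / 2 ^ k) (by positivity) ?_).trans_lt hk⟩
    calc |y p - l| = |(y p - y (r k)) + (y (r k) - z k) + (z k - l)| := by congr 1; abel
      _ ≤ |y p - y (r k)| + |y (r k) - z k| + |z k - l| :=
          (abs_add_le _ _).trans (add_le_add_left (abs_add_le _ _) _)
      _ ≤ (1 / 2 ^ k : ℝ) • e + (1 / 2 ^ k : ℝ) • e + (6 / 2 ^ k : ℝ) • e :=
          add_le_add (add_le_add (hN' k _ _ hp (hr k)) (hyz' k)) (hl k)
      _ = _ := by rw [← add_smul, ← add_smul]; congr 1; ring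

theorem exists_complete_of_calculus (hT : IsLatAlgHomOn {u | PolyGrowth n u} T) (h1 : T 1 = 1)
    {x : Fin n → X} (hx : ∀ i, T (fun t => t i) = x i) :
    ∃ f : X, (1 ≤ f ∧ ∀ i, |x i| ≤ f) ∧
      ∀ m : ℕ, NormComplete (f ^ (m + 1)) {y : X | y ∈ idealSet (f ^ (m + 1)) ∧
        ∀ ε : ℝ, 0 < ε → ∃ z ∈ ⋂₀ {Z : Set X | IsSublatticeSet Z ∧ ∀ i, x i ∈ Z},
          regNorm (f ^ (m + 1)) (y - z) < ε} := by
  set φ : (Fin n → ℝ) → ℝ := fun t => 1 + ∑ i : Fin n, |t i|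
  have hφ : PolyGrowth n φ := polyGrowth_one_add_sum_abs n
  have hf1 : 1 ≤ T φ := by
    rw [← h1]
    exact hT.map_mono (polyGrowth_const n 1) hφ one_le_one_add_sum_abs
  have hfx : ∀ i, |x i| ≤ T φ := fun i => by
    rw [← hx, ← hT.map_abs (polyGrowth_apply i)]
    refine hT.map_mono (polyGrowth_apply i).abs hφ fun t => ?_
    have := Finset.single_le_sum (f := fun j => |t j|) (fun _ _ => abs_nonneg _)
      (Finset.mem_univ i)
    exact this.trans (le_add_of_nonneg_left zero_le_one)
  refine ⟨T φ, ⟨hf1, hfx⟩, fun m => ?_⟩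
  refine hT.normComplete (hφ.pow (m + 1)) (fun t => ?_) (hT.map_pow h1 hφ _)
    (fun z hz => hz _ ⟨hT.isSublatticeSet_image, fun i => ⟨_, polyGrowth_apply i, hx i⟩⟩)
    (fun z hz => hz _ ⟨isSublatticeSet_idealSet _, fun i => ⟨1, zero_le_one, ?_⟩⟩)
  · exact pow_pos (zero_lt_one.trans_le (one_le_one_add_sum_abs t)) _
  · rw [one_smul]
    exact (hfx i).trans (le_self_pow₀ hf1 (by omega))

end Completeness

/-- Corollary 3.2 / `cor:conditions`, characterization part. -/
theorem stmt_12 {X : Type*} [Lattice X] [Ring X] [Module ℝ X]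
    [CovariantClass X X (· + ·) (· ≤ ·)] [IsScalarTower ℝ X X] [SMulCommClass ℝ X X]
    (hsmulpos : ∀ (c : ℝ) (y : X), 0 ≤ c → 0 ≤ y → 0 ≤ c • y)
    (hmulpos : ∀ y z : X, 0 ≤ y → 0 ≤ z → 0 ≤ y * z)
    (harch : ∀ y z : X, 0 ≤ y → 0 ≤ z → (∀ k : ℕ, k • y ≤ z) → y = 0) :
    (∀ (n : ℕ) (x : Fin n → X), ∃ Ψ : ∀ f : (Fin n → ℝ) → ℝ, PolyGrowth n f → X,
        IsLatAlgHom (PolyGrowth n) Ψ ∧ (∀ h1 : PolyGrowth n 1, Ψ 1 h1 = 1) ∧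
        ∀ (i : Fin n) (hi : PolyGrowth n fun t => t i), Ψ (fun t => t i) hi = x i) ↔
    ((∀ a b z : X, a ⊓ b = 0 → 0 ≤ z → (z * a) ⊓ b = 0 ∧ (a * z) ⊓ b = 0) ∧
      ∀ (n : ℕ) (x : Fin n → X), ∃ f : X,
        (Finset.univ.fold (β := X) (· ⊔ ·) 1 fun i => |x i|) ≤ f ∧
        ∀ m : ℕ, NormComplete (f ^ (m + 1))
          {y : X | y ∈ idealSet (f ^ (m + 1)) ∧ ∀ ε : ℝ, 0 < ε →
            ∃ z ∈ ⋂₀ {Z : Set X | IsSublatticeSet Z ∧ ∀ i, x i ∈ Z},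
              regNorm (f ^ (m + 1)) (y - z) < ε}) := by
  have : IsOrderedAddMonoid X := 
    { add_le_add_left := fun a b h c => by
        rw [add_comm a, add_comm b]
        exact CovariantClass.elim c h }
  have : IsOrderedModule ℝ X := .of_smul_nonneg fun c hc y hy => hsmulpos c y hc hy
  have hring : (0 : X) ≤ 1 → IsOrderedRing X := fun h1 =>
    { zero_le_one := h1
      mul_le_mul_of_nonneg_left := fun a ha b c hbc => by
        rw [← sub_nonneg, ← mul_sub]
        exact hmulpos _ _ ha (sub_nonneg.2 hbc)
      mul_le_mul_of_nonneg_right := fun a ha b c hbc => by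
        rw [← sub_nonneg, ← sub_mul]
        exact hmulpos _ _ (sub_nonneg.2 hbc) ha }
  simp only [sup_abs_le_iff]
  constructor
  · intro h
    have hcalc : ∀ (n : ℕ) (x : Fin n → X), ∃ T : ((Fin n → ℝ) → ℝ) → X,
        IsLatAlgHomOn {u | PolyGrowth n u} T ∧ T 1 = 1 ∧ ∀ i, T (fun t => t i) = x i := by
      intro n x
      obtain ⟨Ψ, hΨ, h1, hx⟩ := h n x
      obtain ⟨T, hT, hTΨ⟩ := exists_isLatAlgHomOn hΨ
      exact ⟨T, hT, (hTΨ 1 (polyGrowth_const n 1)).trans (h1 _),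
        fun i => (hTΨ _ (polyGrowth_apply i)).trans (hx i _)⟩
    refine ⟨fun a b z hab hz => ?_, fun n x => ?_⟩
    · obtain ⟨T, hT, -, hx⟩ := hcalc 3 ![a, b, z]
      exact fAlgebra_of_calculus hmulpos hT (hx 0) (hx 1) (hx 2) hab hz
    · obtain ⟨T, hT, h1, hx⟩ := hcalc n x
      have := hring (by
        rw [← h1, ← hT.map_zero]
        exact hT.map_mono (polyGrowth_const n 0) (polyGrowth_const n 1) fun _ => zero_le_one)
      exact exists_complete_of_calculus hT h1 hx
  · rintro ⟨hF, hcomp⟩ n x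
    have := hring (one_nonneg_of_fAlgebra hmulpos hF)
    obtain ⟨f, ⟨hf, hxf⟩, hcomp⟩ := hcomp (n + 1) (Fin.cons 1 x)
    have hgen : ∀ Z ∈ {Z : Set X | IsSublatticeSet Z ∧ ∀ i, (Fin.cons 1 x : Fin (n + 1) → X) i ∈ Z},
        ∀ i, (Fin.cons 1 x : Fin (n + 1) → X) i ∈ Z := fun Z hZ => hZ.2
    exact exists_polyGrowth_calculus hF harch hf (fun i => by simpa using hxf i.succ)
      (isSublatticeSet_sInter _) (fun Z hZ => by simpa using hgen Z hZ 0)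
      (fun i Z hZ => by simpa using hgen Z hZ i.succ)
      (fun z hz => hz _ ⟨isSublatticeSet_idealSet f, fun i => ⟨1, zero_le_one, by
        rw [one_smul]; exact hxf i⟩⟩) hcomp
end

section
/- Let K be a compact Hausdorff topological space and let s₀ ∈ K. Let X = { f ∈ C(K, ℝ) : f is constant on some neighborhood of s₀ }, regarded as a sublattice-algebra of C(K, ℝ) with the pointwise operations and order, containing the constant-one function 𝟙_K. Then X admits a polynomial growth continuous function calculus: for every n ∈ ℕ and every f₁, …, fₙ ∈ X there exists a lattice-algebra homomorphism Ψ : PG_n → X with Ψ(𝟙) = 𝟙_K and Ψ(πᵢ) = fᵢ for i = 1, …, n. -/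
open scoped BigOperators

/-- Example 3.9: the sublattice-algebra of `C(K)` of functions that are
constant on some neighborhood of `s₀` admits a polynomial growth continuous function
calculus. -/
theorem stmt_19 (K : Type*) [TopologicalSpace K] [CompactSpace K] [T2Space K] (s₀ : K) :
    let X : Set C(K, ℝ) := {f : C(K, ℝ) | ∃ U ∈ nhds s₀, ∀ x ∈ U, f x = f s₀}
    ∀ (n : ℕ) (g : Fin n → C(K, ℝ)), (∀ i, g i ∈ X) →
      ∃ Ψ : ∀ f : (Fin n → ℝ) → ℝ, PolyGrowth n f → C(K, ℝ),
        (∀ (f : (Fin n → ℝ) → ℝ) (hf : PolyGrowth n f), Ψ f hf ∈ X) ∧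
        IsLatAlgHom (PolyGrowth n) Ψ ∧
        (∀ h1 : PolyGrowth n 1, Ψ 1 h1 = 1) ∧
        (∀ (i : Fin n) (hi : PolyGrowth n fun t => t i), Ψ (fun t => t i) hi = g i) := by
  intro X n g hg
  refine ⟨fun f hf => ⟨fun x => f fun i => g i x,
    hf.1.comp (continuous_pi fun i => (g i).continuous)⟩, fun f hf => ?_,
    ⟨⟨fun _ _ _ _ _ => rfl, fun _ _ _ _ => rfl, fun _ _ _ _ _ => rfl⟩,
      fun _ _ _ _ _ => rfl⟩, fun _ => rfl, fun _ _ => rfl⟩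
  have h : ∀ i, ∀ᶠ x in nhds s₀, g i x = g i s₀ := fun i =>
    let ⟨_, hU, hconst⟩ := hg i
    Filter.mem_of_superset hU hconst
  refine ⟨_, Filter.eventually_all.2 h, fun x hx => ?_⟩
  exact congrArg f (funext hx)
end
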